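/- arXiv:2506.02816 — 5 statements merged into one kernel-verified Lean document; each statement's English description precedes it below -/
import Mathlib

section
/- Every eigenvalue λ of 𝒫_D^{-1}𝒜 is real, and for each such eigenvalue there exist an integer k with 1 ≤ k ≤ N+1 and parameters γ_1, …, γ_{k-1} ∈ (0,1] such that U_k(λ, γ) = 0. -/
noncomputable section
open Matrix

/-- The parametric polynomials `U_k(x, γ)` (as real-valued functions), defined by
`U_0 = 1`, `U_1 = x - 1`, and
`U_{k+1}(x,γ) = ((-1)^{k+1} (1 - γ_k) + x) U_k(x,γ) - γ_k U_{k-1}(x,γ)` for `k ≥ 1`. -/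
def Ufun (γ : ℕ → ℝ) : ℕ → ℝ → ℝ
  | 0, _ => 1
  | 1, x => x - 1
  | k+2, x => ((-1 : ℝ)^(k+2) * (1 - γ (k+1)) + x) * Ufun γ (k+1) x - γ (k+1) * Ufun γ k x

/-- The symmetric block tridiagonal multiple saddle-point matrix `𝒜` with diagonal blocks
`(-1)^k A_k` (for `k = 0, …, N`) and sub-diagonal blocks `B_k` (here `B k` is the block
coupling levels `k` and `k+1`, i.e. the paper's `B_{k+1}`), super-diagonal blocks `B_kᵀ`. -/
def blockTri (N : ℕ) (n : ℕ → ℕ)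
    (A : ∀ k : ℕ, Matrix (Fin (n k)) (Fin (n k)) ℝ)
    (B : ∀ k : ℕ, Matrix (Fin (n (k + 1))) (Fin (n k)) ℝ) :
    Matrix (Σ k : Fin (N + 1), Fin (n k.val)) (Σ k : Fin (N + 1), Fin (n k.val)) ℝ :=
  fun p q =>
    if h : (p.1 : ℕ) = (q.1 : ℕ) then
      (-1 : ℝ) ^ (p.1 : ℕ) * A (p.1 : ℕ) p.2 (Fin.cast (congrArg n h.symm) q.2)
    else if h2 : (p.1 : ℕ) = (q.1 : ℕ) + 1 then
      B (q.1 : ℕ) (Fin.cast (congrArg n h2) p.2) q.2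
    else if h3 : (q.1 : ℕ) = (p.1 : ℕ) + 1 then
      B (p.1 : ℕ) (Fin.cast (congrArg n h3) q.2) p.2
    else 0

/-- The Schur complements `S_0 = A_0`, `S_{k+1} = A_{k+1} + B_k S_k⁻¹ B_kᵀ`. -/
def schurComp (n : ℕ → ℕ)
    (A : ∀ k : ℕ, Matrix (Fin (n k)) (Fin (n k)) ℝ)
    (B : ∀ k : ℕ, Matrix (Fin (n (k + 1))) (Fin (n k)) ℝ) :
    ∀ k : ℕ, Matrix (Fin (n k)) (Fin (n k)) ℝ
  | 0 => A 0
  | k+1 => A (k + 1) + B k * (schurComp n A B k)⁻¹ * (B k)ᵀ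

/-- Replacing one parameter past the ones `U_k` depends on does not change `U_k`. -/
lemma Ufun_update (γ : ℕ → ℝ) (x g : ℝ) (m : ℕ) :
    ∀ k ≤ m, Ufun (Function.update γ m g) k x = Ufun γ k x
  | 0, _ => by simp [Ufun]
  | 1, _ => by simp [Ufun]
  | k + 2, h => by
    have hne : k + 1 ≠ m := by omega
    simp only [Ufun, Function.update_of_ne hne, Ufun_update γ x g m k (by omega),
      Ufun_update γ x g m (k + 1) (by omega)]

lemma continuous_Ufun (x : ℝ) : ∀ k, Continuous fun γ => Ufun γ k x
  | 0 => by simpa only [Ufun] using continuous_const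
  | 1 => by simpa only [Ufun] using continuous_const
  | k + 2 => by
    have h0 := continuous_Ufun x k
    have h1 := continuous_Ufun x (k + 1)
    simp only [Ufun]
    fun_prop

/-- The values of `U_{k+1}(x, γ) / U_k(x, γ)` as `γ` ranges over sequences in `(0, 1]`. -/
def ratioSet (x : ℝ) (k : ℕ) : Set ℝ :=
  (fun γ => Ufun γ (k + 1) x / Ufun γ k x) '' Set.univ.pi fun _ : ℕ => Set.Ioc (0 : ℝ) 1

lemma ordConnected_ratioSet {x : ℝ} {k : ℕ}
    (h : ∀ γ : ℕ → ℝ, (∀ j, γ j ∈ Set.Ioc (0 : ℝ) 1) → Ufun γ k x ≠ 0) :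
    (ratioSet x k).OrdConnected := by
  refine ((isPreconnected_univ_pi fun _ => isPreconnected_Ioc).image _ ?_).ordConnected
  exact (continuous_Ufun x _).continuousOn.div (continuous_Ufun x _).continuousOn
    fun γ hγ => h γ fun j => hγ j trivial

lemma exists_mem_ratioSet_succ {x r g : ℝ} {k : ℕ}
    (h : ∀ γ : ℕ → ℝ, (∀ j, γ j ∈ Set.Ioc (0 : ℝ) 1) → Ufun γ (k + 1) x ≠ 0)
    (hr : r ∈ ratioSet x k) (hg : g ∈ Set.Ioc (0 : ℝ) 1) :
    (-1 : ℝ) ^ (k + 2) * (1 - g) + x - g * r⁻¹ ∈ ratioSet x (k + 1) := by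
  obtain ⟨γ, hγ, rfl⟩ := hr
  refine ⟨Function.update γ (k + 1) g, fun j _ => ?_, ?_⟩
  · by_cases hj : j = k + 1
    · subst hj; simpa using hg
    · simpa [Function.update_of_ne hj] using hγ j trivial
  · have hne := h γ fun j => hγ j trivial
    simp only [Ufun, Ufun_update γ x g (k + 1) k (by omega),
      Ufun_update γ x g (k + 1) (k + 1) le_rfl, Function.update_self, inv_div]
    field_simp

section QuadraticForms

variable {m : Type*} [Fintype m]

lemma Matrix.IsHermitian.dotProduct_mulVec_comm {M : Matrix m m ℝ} (hM : M.IsHermitian)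
    (x y : m → ℝ) : x ⬝ᵥ M *ᵥ y = y ⬝ᵥ M *ᵥ x := by
  have hT : Mᵀ = M := by simpa using hM.eq
  rw [dotProduct_mulVec, ← mulVec_transpose, hT, dotProduct_comm]

lemma Matrix.PosDef.dotProduct_mulVec_pos_real {M : Matrix m m ℝ} (hM : M.PosDef) {x : m → ℝ}
    (hx : x ≠ 0) : 0 < x ⬝ᵥ M *ᵥ x := by
  simpa using hM.dotProduct_mulVec_pos hx

lemma Matrix.PosDef.sq_dotProduct_mulVec_le {M : Matrix m m ℝ} (hM : M.PosDef) (x y : m → ℝ) :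
    (x ⬝ᵥ M *ᵥ y) ^ 2 ≤ (x ⬝ᵥ M *ᵥ x) * (y ⬝ᵥ M *ᵥ y) := by
  classical
  have := (Matrix.toBilin' M).apply_sq_le_of_symm
    (fun x => by simpa [Matrix.toBilin'_apply'] using hM.posSemidef.dotProduct_mulVec_nonneg x)
    ⟨fun x y => by simpa [Matrix.toBilin'_apply'] using hM.isHermitian.dotProduct_mulVec_comm x y⟩
    x y
  simpa [Matrix.toBilin'_apply'] using this

variable [DecidableEq m]

/-- If the generalized Rayleigh quotients of `(T, S)` lie in an interval of positive numbers, so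
do the quotients of `(S⁻¹, T⁻¹)`. -/
lemma rayleigh_inv_of_pos {S T : Matrix m m ℝ} (hS : S.PosDef) (hT : T.IsHermitian) {I : Set ℝ}
    (hI : I.OrdConnected) (hpos : ∀ r ∈ I, 0 < r)
    (h : ∀ w ≠ 0, ∃ r ∈ I, w ⬝ᵥ T *ᵥ w = r * (w ⬝ᵥ S *ᵥ w)) {z : m → ℝ} (hz : z ≠ 0) :
    ∃ r ∈ I, z ⬝ᵥ S⁻¹ *ᵥ z = r * (z ⬝ᵥ T⁻¹ *ᵥ z) := by
  have hTp : T.PosDef := by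
    refine .of_dotProduct_mulVec_pos hT fun w hw => ?_
    obtain ⟨r, hr, e⟩ := h w hw
    simpa [e] using mul_pos (hpos r hr) (hS.dotProduct_mulVec_pos_real hw)
  have hSu : S * S⁻¹ = 1 := mul_nonsing_inv _ ((isUnit_iff_isUnit_det S).1 hS.isUnit)
  have hTu : T * T⁻¹ = 1 := mul_nonsing_inv _ ((isUnit_iff_isUnit_det T).1 hTp.isUnit)
  set u := T⁻¹ *ᵥ z with hu
  set y := S⁻¹ *ᵥ z with hy
  have hTuz : T *ᵥ u = z := by rw [hu, mulVec_mulVec, hTu, one_mulVec]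
  have hSyz : S *ᵥ y = z := by rw [hy, mulVec_mulVec, hSu, one_mulVec]
  have hu0 : u ≠ 0 := fun e => hz (by rw [← hTuz, e, mulVec_zero])
  have hy0 : y ≠ 0 := fun e => hz (by rw [← hSyz, e, mulVec_zero])
  have hzu : 0 < z ⬝ᵥ u := by
    simpa only [hTuz, dotProduct_comm] using hTp.dotProduct_mulVec_pos_real hu0
  have hzy : 0 < z ⬝ᵥ y := by
    simpa only [hSyz, dotProduct_comm] using hS.dotProduct_mulVec_pos_real hy0
  obtain ⟨a, ha, ea⟩ := h u hu0
  obtain ⟨b, hb, eb⟩ := h y hy0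
  have c1 := hS.sq_dotProduct_mulVec_le u y
  have c2 := hTp.sq_dotProduct_mulVec_le y u
  rw [hTuz, dotProduct_comm u z] at ea
  rw [hSyz, dotProduct_comm y z] at eb
  rw [hSyz, dotProduct_comm u z, dotProduct_comm y z] at c1
  rw [hTuz, eb, dotProduct_comm u z, dotProduct_comm y z] at c2
  refine ⟨z ⬝ᵥ y / z ⬝ᵥ u, hI.out ha hb ⟨?_, ?_⟩, by field_simp⟩
  · rw [le_div_iff₀ hzu]
    have := hpos a ha
    have huS := hS.dotProduct_mulVec_pos_real hu0
    refine le_of_mul_le_mul_right ?_ huS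
    nlinarith
  · rw [div_le_iff₀ hzu]
    refine le_of_mul_le_mul_right ?_ hzy
    nlinarith

lemma rayleigh_inv {S T : Matrix m m ℝ} (hS : S.PosDef) (hT : T.IsHermitian) {I : Set ℝ}
    (hI : I.OrdConnected) (h0 : (0 : ℝ) ∉ I)
    (h : ∀ w ≠ 0, ∃ r ∈ I, w ⬝ᵥ T *ᵥ w = r * (w ⬝ᵥ S *ᵥ w)) {z : m → ℝ} (hz : z ≠ 0) :
    ∃ r ∈ I, z ⬝ᵥ S⁻¹ *ᵥ z = r * (z ⬝ᵥ T⁻¹ *ᵥ z) := by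
  by_cases hpos : ∀ r ∈ I, 0 < r
  · exact rayleigh_inv_of_pos hS hT hI hpos h hz
  · push Not at hpos
    obtain ⟨a, ha, ha0⟩ := hpos
    have hneg : ∀ r ∈ I, r < 0 := fun r hr => by
      by_contra! hr0
      exact h0 (hI.out ha hr ⟨ha0, hr0⟩)
    have hinv : (-T)⁻¹ = -T⁻¹ := by
      by_cases hu : IsUnit T.det
      · exact inv_eq_left_inv (by simp [nonsing_inv_mul _ hu])
      · rw [nonsing_inv_apply_not_isUnit _ hu, nonsing_inv_apply_not_isUnit, neg_zero]
        rw [← isUnit_iff_isUnit_det] at hu ⊢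
        rwa [IsUnit.neg_iff]
    have hIneg : (-I).OrdConnected := ⟨fun x hx y hy t ht =>
      hI.out hy hx ⟨neg_le_neg ht.2, neg_le_neg ht.1⟩⟩
    obtain ⟨r, hr, e⟩ := rayleigh_inv_of_pos hS hT.neg hIneg
      (fun r hr => by have := hneg (-r) hr; linarith)
      (fun w hw => by
        obtain ⟨r, hr, e⟩ := h w hw
        exact ⟨-r, by simpa using hr, by simp [neg_mulVec, e]⟩) hz
    exact ⟨-r, hr, by simpa [hinv, neg_mulVec] using e⟩

lemma isUnit_det_of_rayleigh {S T : Matrix m m ℝ} (hS : S.PosDef) {I : Set ℝ} (h0 : (0 : ℝ) ∉ I)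
    (h : ∀ w ≠ 0, ∃ r ∈ I, w ⬝ᵥ T *ᵥ w = r * (w ⬝ᵥ S *ᵥ w)) : IsUnit T.det := by
  rw [isUnit_iff_ne_zero]
  intro hdet
  obtain ⟨w, hw, e⟩ := exists_mulVec_eq_zero_iff.2 hdet
  obtain ⟨r, hr, e'⟩ := h w hw
  rw [e, dotProduct_zero, eq_comm, mul_eq_zero] at e'
  rcases e' with rfl | e'
  · exact h0 hr
  · exact (hS.dotProduct_mulVec_pos_real hw).ne' e'

end QuadraticForms

/-- The eigenvalues of a symmetric pencil with positive definite right-hand side are real, with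
real eigenvectors. -/
lemma exists_real_eigenpair {m : Type*} [Fintype m] {M P : Matrix m m ℝ} (hM : M.IsHermitian)
    (hP : P.PosDef) {lam : ℂ} {v : m → ℂ} (hv : v ≠ 0)
    (h : (M.map fun x : ℝ => (x : ℂ)) *ᵥ v = lam • (P.map fun x : ℝ => (x : ℂ)) *ᵥ v) :
    ∃ (r : ℝ) (x : m → ℝ), lam = r ∧ x ≠ 0 ∧ M *ᵥ x = r • P *ᵥ x := by
  set x : m → ℝ := fun i => (v i).re
  set y : m → ℝ := fun i => (v i).im
  have re_mulVec (Q : Matrix m m ℝ) (i) :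
      (((Q.map fun x : ℝ => (x : ℂ)) *ᵥ v) i).re = (Q *ᵥ x) i := by
    simp [mulVec, dotProduct, x]
  have im_mulVec (Q : Matrix m m ℝ) (i) :
      (((Q.map fun x : ℝ => (x : ℂ)) *ᵥ v) i).im = (Q *ᵥ y) i := by
    simp [mulVec, dotProduct, y]
  have hx : M *ᵥ x = lam.re • P *ᵥ x - lam.im • P *ᵥ y := by
    ext i
    simpa [re_mulVec, im_mulVec] using congrArg Complex.re (congrFun h i)
  have hy : M *ᵥ y = lam.re • P *ᵥ y + lam.im • P *ᵥ x := by
    ext i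
    simpa [re_mulVec, im_mulVec] using congrArg Complex.im (congrFun h i)
  have hxy : x ≠ 0 ∨ y ≠ 0 := by
    by_contra! hc
    exact hv (funext fun i => Complex.ext (congrFun hc.1 i) (congrFun hc.2 i))
  have key := hM.dotProduct_mulVec_comm x y
  rw [hx, hy, dotProduct_add, dotProduct_sub, dotProduct_smul, dotProduct_smul, dotProduct_smul,
    dotProduct_smul, hP.isHermitian.dotProduct_mulVec_comm x y] at key
  have hpos : 0 < x ⬝ᵥ P *ᵥ x + y ⬝ᵥ P *ᵥ y := by
    have nonneg (w : m → ℝ) : 0 ≤ w ⬝ᵥ P *ᵥ w := by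
      simpa using hP.posSemidef.dotProduct_mulVec_nonneg w
    rcases hxy with h | h
    · linarith [hP.dotProduct_mulVec_pos_real h, nonneg y]
    · linarith [hP.dotProduct_mulVec_pos_real h, nonneg x]
  have him : lam.im = 0 := by
    refine (mul_eq_zero.1 (?_ : lam.im * (x ⬝ᵥ P *ᵥ x + y ⬝ᵥ P *ᵥ y) = 0)).resolve_right hpos.ne'
    simp only [smul_eq_mul] at key
    linarith
  have hlam : lam = (lam.re : ℂ) := Complex.ext rfl him
  rw [him, zero_smul] at hx hy
  rcases hxy with h | h
  · exact ⟨lam.re, x, hlam, h, by simpa using hx⟩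
  · exact ⟨lam.re, y, hlam, h, by simpa using hy⟩

lemma Matrix.transpose_mulVec_ne_zero {p q : ℕ} {B : Matrix (Fin p) (Fin q) ℝ} (hB : B.rank = p)
    {w : Fin p → ℝ} (hw : w ≠ 0) : Bᵀ *ᵥ w ≠ 0 := by
  have hinj : Function.Injective B.vecMul := by
    rw [vecMul_injective_iff, linearIndependent_iff_card_eq_finrank_span, Fintype.card_fin,
      Set.finrank, ← rank_eq_finrank_span_row, hB]
  rw [mulVec_transpose]
  exact fun h => hw (hinj (by simpa using h))

section BlockMatrices

variable {N : ℕ} {n : ℕ → ℕ} {A : ∀ k : ℕ, Matrix (Fin (n k)) (Fin (n k)) ℝ}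
  {B : ∀ k : ℕ, Matrix (Fin (n (k + 1))) (Fin (n k)) ℝ}

lemma posDef_schurComp (hA0 : (A 0).PosDef) (hA : ∀ k, 1 ≤ k → k ≤ N → (A k).PosSemidef)
    (hB : ∀ k < N, (B k).rank = n (k + 1)) : ∀ k ≤ N, (schurComp n A B k).PosDef
  | 0, _ => hA0
  | k + 1, hk => by
    have ih := (posDef_schurComp hA0 hA hB k (by omega)).inv
    have hC : (B k * (schurComp n A B k)⁻¹ * (B k)ᵀ).PosDef := by
      refine .of_dotProduct_mulVec_pos ?_ fun w hw => ?_
      · simpa using (ih.posSemidef.mul_mul_conjTranspose_same (B k)).isHermitian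
      · have := ih.dotProduct_mulVec_pos_real (transpose_mulVec_ne_zero (hB k hk) hw)
        rw [star_trivial, ← mulVec_mulVec, ← mulVec_mulVec, dotProduct_mulVec, ← mulVec_transpose]
        exact this
    exact hC.posSemidef_add (hA (k + 1) (by omega) hk)

lemma isHermitian_blockTri (hA : ∀ k ≤ N, (A k).IsHermitian) : (blockTri N n A B).IsHermitian := by
  ext ⟨⟨k, hk⟩, i⟩ ⟨⟨l, hl⟩, j⟩
  simp only [conjTranspose_apply, star_trivial, blockTri]
  by_cases h : k = l
  · subst h
    simpa using (hA k (by omega)).apply i j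
  · by_cases h2 : k = l + 1
    · subst h2
      simp [show l ≠ l + 1 + 1 by omega]
    · by_cases h3 : l = k + 1
      · subst h3
        simp [show k ≠ k + 1 + 1 by omega]
      · simp [h, h2, h3, Ne.symm h]

/-- The `k`-th block of a block vector, extended by zero to all `k`. -/
def blockVec (x : (Σ k : Fin (N + 1), Fin (n k.val)) → ℝ) (k : ℕ) (i : Fin (n k)) : ℝ :=
  if h : k < N + 1 then x ⟨⟨k, h⟩, i⟩ else 0

lemma blockVec_val (x : (Σ k : Fin (N + 1), Fin (n k.val)) → ℝ) (k : Fin (N + 1)) (i) :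
    blockVec x k i = x ⟨k, i⟩ :=
  dif_pos k.2

/-- The contribution of the sub-diagonal block to the `k`-th block row. -/
def lowerPart (B : ∀ k : ℕ, Matrix (Fin (n (k + 1))) (Fin (n k)) ℝ) (w : ∀ k, Fin (n k) → ℝ) :
    ∀ k, Fin (n k) → ℝ
  | 0 => 0
  | k + 1 => B k *ᵥ w k

lemma blockTri_mulVec_apply (x : (Σ k : Fin (N + 1), Fin (n k.val)) → ℝ) {k : ℕ} (hk : k < N + 1)
    (i : Fin (n k)) :
    (blockTri N n A B *ᵥ x) ⟨⟨k, hk⟩, i⟩ = (-1) ^ k * (A k *ᵥ blockVec x k) i +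
      ((B k)ᵀ *ᵥ blockVec x (k + 1)) i + lowerPart B (blockVec x) k i := by
  have hrow (l : Fin (N + 1)) :
      ∑ j, blockTri N n A B ⟨⟨k, hk⟩, i⟩ ⟨l, j⟩ * x ⟨l, j⟩ =
        (if k = (l : ℕ) then (-1) ^ k * (A k *ᵥ blockVec x k) i else 0) +
        (if k + 1 = (l : ℕ) then ((B k)ᵀ *ᵥ blockVec x (k + 1)) i else 0) +
        (if k = (l : ℕ) + 1 then lowerPart B (blockVec x) k i else 0) := by
    obtain ⟨l, hl⟩ := l
    by_cases h : k = l
    · subst h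
      simp [blockTri, mulVec, dotProduct, blockVec, hk, Finset.mul_sum, mul_assoc]
    · by_cases h2 : k = l + 1
      · subst h2
        simp [blockTri, mulVec, dotProduct, blockVec, hl, lowerPart, show l + 1 + 1 ≠ l by omega]
      · by_cases h3 : l = k + 1
        · subst h3
          simp [blockTri, mulVec, dotProduct, blockVec, hl, h2]
        · simp [blockTri, h, h2, h3, Ne.symm h3]
  rw [mulVec, dotProduct, Fintype.sum_sigma, Finset.sum_congr rfl fun l _ => hrow l,
    Fin.sum_univ_eq_sum_range fun l : ℕ =>
        (if k = l then (-1) ^ k * (A k *ᵥ blockVec x k) i else 0) +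
        (if k + 1 = l then ((B k)ᵀ *ᵥ blockVec x (k + 1)) i else 0) +
        (if k = l + 1 then lowerPart B (blockVec x) k i else 0),
    Finset.sum_add_distrib, Finset.sum_add_distrib, Finset.sum_ite_eq, Finset.sum_ite_eq,
    if_pos (Finset.mem_range.2 hk)]
  congr 2
  · by_cases h : k + 1 < N + 1
    · rw [if_pos (Finset.mem_range.2 h)]
    · have h0 : blockVec x (k + 1) = 0 := funext fun j => dif_neg h
      simp [h0]
  · cases k with
    | zero => simp [lowerPart]
    | succ k => simp [show k < N + 1 by omega]

lemma blockDiagonal'_mulVec_apply (D : ∀ k : ℕ, Matrix (Fin (n k)) (Fin (n k)) ℝ)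
    (x : (Σ k : Fin (N + 1), Fin (n k.val)) → ℝ) {k : ℕ} (hk : k < N + 1) (i : Fin (n k)) :
    (blockDiagonal' (fun k : Fin (N + 1) => D k) *ᵥ x) ⟨⟨k, hk⟩, i⟩ = (D k *ᵥ blockVec x k) i := by
  rw [mulVec, dotProduct, Fintype.sum_sigma, Finset.sum_eq_single ⟨k, hk⟩]
  · simp [mulVec, dotProduct, blockVec, hk, blockDiagonal'_apply_eq]
  · intro l _ hl
    simp [blockDiagonal'_apply_ne _ _ _ hl.symm]
  · simp

lemma posDef_blockDiagonal' {D : ∀ k : ℕ, Matrix (Fin (n k)) (Fin (n k)) ℝ}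
    (hD : ∀ k ≤ N, (D k).PosDef) : (blockDiagonal' fun k : Fin (N + 1) => D k).PosDef := by
  refine .of_dotProduct_mulVec_pos ?_ fun x hx => ?_
  · rw [IsHermitian, blockDiagonal'_conjTranspose]
    exact congrArg blockDiagonal' (funext fun k => (hD k (by omega)).isHermitian)
  · have hsum : star x ⬝ᵥ (blockDiagonal' fun k : Fin (N + 1) => D k) *ᵥ x =
        ∑ k : Fin (N + 1), blockVec x k ⬝ᵥ D k *ᵥ blockVec x k := by
      rw [star_trivial, dotProduct, Fintype.sum_sigma]
      refine Finset.sum_congr rfl fun k _ => Finset.sum_congr rfl fun i _ => ?_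
      rw [blockDiagonal'_mulVec_apply D x k.2 i]
      rw [blockVec_val]
    rw [hsum]
    obtain ⟨⟨k, i⟩, hki⟩ := Function.ne_iff.1 hx
    have hne : blockVec x k ≠ 0 := fun h0 => hki (by simpa [blockVec_val] using congrFun h0 i)
    refine Finset.sum_pos' (fun k _ => ?_)
      ⟨k, Finset.mem_univ _, (hD k (by omega)).dotProduct_mulVec_pos_real hne⟩
    simpa using (hD k (by omega)).posSemidef.dotProduct_mulVec_nonneg (blockVec x k)

/-- The pivots of block Gaussian elimination applied to `x 𝒫_D - 𝒜`. -/
def pivot (n : ℕ → ℕ) (A : ∀ k : ℕ, Matrix (Fin (n k)) (Fin (n k)) ℝ)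
    (B : ∀ k : ℕ, Matrix (Fin (n (k + 1))) (Fin (n k)) ℝ) (x : ℝ) :
    ∀ k, Matrix (Fin (n k)) (Fin (n k)) ℝ
  | 0 => (x - 1) • A 0
  | k + 1 => x • schurComp n A B (k + 1) - (-1 : ℝ) ^ (k + 1) • A (k + 1) -
      B k * (pivot n A B x k)⁻¹ * (B k)ᵀ

lemma rayleigh_pivot (hA0 : (A 0).PosDef) (hA : ∀ k, 1 ≤ k → k ≤ N → (A k).PosSemidef)
    (hB : ∀ k < N, (B k).rank = n (k + 1)) {x : ℝ}
    (hU : ∀ k ≤ N + 1, ∀ γ : ℕ → ℝ, (∀ j, γ j ∈ Set.Ioc (0 : ℝ) 1) → Ufun γ k x ≠ 0) :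
    ∀ k ≤ N, (pivot n A B x k).IsHermitian ∧ ∀ w ≠ 0, ∃ r ∈ ratioSet x k,
      w ⬝ᵥ pivot n A B x k *ᵥ w = r * (w ⬝ᵥ schurComp n A B k *ᵥ w)
  | 0, _ => by
    refine ⟨hA0.isHermitian.smul (.all _), fun w _ => ⟨x - 1, ⟨fun _ => 1, ?_, ?_⟩, ?_⟩⟩
    · simp
    · simp [Ufun]
    · simp [pivot, schurComp, smul_mulVec]
  | k + 1, hk => by
    obtain ⟨hT, hR⟩ := rayleigh_pivot hA0 hA hB hU k (by omega)
    have hS := posDef_schurComp hA0 hA hB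
    have hAk := hA (k + 1) (by omega) hk
    refine ⟨((hS _ hk).isHermitian.smul (.all _)).sub (hAk.isHermitian.smul (.all _)) |>.sub ?_,
      fun w hw => ?_⟩
    · simpa using isHermitian_mul_mul_conjTranspose (B k) hT.inv
    set z := (B k)ᵀ *ᵥ w with hz
    have hz0 : z ≠ 0 := transpose_mulVec_ne_zero (hB k hk) hw
    have h0 : (0 : ℝ) ∉ ratioSet x k := by
      rintro ⟨γ, hγ, h⟩
      exact div_ne_zero (hU (k + 1) (by omega) γ fun j => hγ j trivial)
        (hU k (by omega) γ fun j => hγ j trivial) h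
    obtain ⟨r, hr, e⟩ := rayleigh_inv (hS k (by omega)) hT
      (ordConnected_ratioSet (hU k (by omega))) h0 hR hz0
    have conj (M : Matrix (Fin (n k)) (Fin (n k)) ℝ) :
        w ⬝ᵥ (B k * M * (B k)ᵀ) *ᵥ w = z ⬝ᵥ M *ᵥ z := by
      rw [← mulVec_mulVec, ← mulVec_mulVec, dotProduct_mulVec, ← mulVec_transpose]
    have hq := (hS (k + 1) hk).dotProduct_mulVec_pos_real hw
    have hs := (hS k (by omega)).inv.dotProduct_mulVec_pos_real hz0
    have ha : 0 ≤ w ⬝ᵥ A (k + 1) *ᵥ w := by simpa using hAk.dotProduct_mulVec_nonneg w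
    have hsplit : w ⬝ᵥ schurComp n A B (k + 1) *ᵥ w =
        w ⬝ᵥ A (k + 1) *ᵥ w + z ⬝ᵥ (schurComp n A B k)⁻¹ *ᵥ z := by
      rw [schurComp, add_mulVec, dotProduct_add, conj]
    have hr0 : r ≠ 0 := fun h => h0 (h ▸ hr)
    refine ⟨_, exists_mem_ratioSet_succ (hU (k + 1) (by omega)) hr
      (g := z ⬝ᵥ (schurComp n A B k)⁻¹ *ᵥ z / w ⬝ᵥ schurComp n A B (k + 1) *ᵥ w)
      ⟨div_pos hs hq, (div_le_one hq).2 (by linarith)⟩, ?_⟩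
    rw [pivot, sub_mulVec, sub_mulVec, smul_mulVec, smul_mulVec, dotProduct_sub, dotProduct_sub,
      dotProduct_smul, dotProduct_smul, conj, smul_eq_mul, smul_eq_mul,
      show z ⬝ᵥ (pivot n A B x k)⁻¹ *ᵥ z = r⁻¹ * (z ⬝ᵥ (schurComp n A B k)⁻¹ *ᵥ z) by
        rw [e, inv_mul_cancel_left₀ hr0],
      eq_sub_of_add_eq hsplit.symm]
    field_simp
    ring

end BlockMatrices

/-- every eigenvalue `λ` of `𝒫_D⁻¹ 𝒜` (i.e. of the pencil `𝒜 v = λ 𝒫_D v`,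
considered over `ℂ`) is real, and there exist `1 ≤ k ≤ N+1` and parameters
`γ₁, …, γ_{k-1} ∈ (0,1]` with `U_k(λ, γ) = 0`. -/
theorem stmt0 (N : ℕ) (hN : 1 ≤ N) (n : ℕ → ℕ) (hnN : 1 ≤ n N)
    (hmono : ∀ k < N, n (k + 1) ≤ n k)
    (A : ∀ k : ℕ, Matrix (Fin (n k)) (Fin (n k)) ℝ)
    (B : ∀ k : ℕ, Matrix (Fin (n (k + 1))) (Fin (n k)) ℝ)
    (hA0 : (A 0).PosDef)
    (hA : ∀ k, 1 ≤ k → k ≤ N → (A k).PosSemidef)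
    (hB : ∀ k < N, (B k).rank = n (k + 1))
    (lam : ℂ)
    (hlam : ∃ v : (Σ k : Fin (N + 1), Fin (n k.val)) → ℂ, v ≠ 0 ∧
      ((blockTri N n A B).map (fun x : ℝ => (x : ℂ))).mulVec v =
        lam • ((Matrix.blockDiagonal'
          (fun k : Fin (N + 1) => schurComp n A B (k : ℕ))).map
            (fun x : ℝ => (x : ℂ))).mulVec v) :
    ∃ (r : ℝ) (k : ℕ) (γ : ℕ → ℝ), lam = (r : ℂ) ∧ 1 ≤ k ∧ k ≤ N + 1 ∧
      (∀ j, 1 ≤ j → j ≤ k - 1 → γ j ∈ Set.Ioc (0 : ℝ) 1) ∧ Ufun γ k r = 0 := by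
  obtain ⟨v, hv, hlam⟩ := hlam
  have hA' : ∀ k ≤ N, (A k).IsHermitian := fun k hk => by
    rcases Nat.eq_zero_or_pos k with rfl | h
    · exact hA0.isHermitian
    · exact (hA k h hk).isHermitian
  have hS := posDef_schurComp hA0 hA hB
  obtain ⟨r, x, hr, hx, heig⟩ := exists_real_eigenpair (isHermitian_blockTri hA')
    (posDef_blockDiagonal' hS) hv hlam
  by_contra hcon
  have hU : ∀ k ≤ N + 1, ∀ γ : ℕ → ℝ, (∀ j, γ j ∈ Set.Ioc (0 : ℝ) 1) → Ufun γ k r ≠ 0 := by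
    intro k hk γ hγ h0
    rcases Nat.eq_zero_or_pos k with rfl | h
    · simp [Ufun] at h0
    · exact hcon ⟨r, k, γ, hr, h, hk, fun j _ _ => hγ j, h0⟩
  have hunit : ∀ k ≤ N, IsUnit (pivot n A B r k).det := fun k hk => by
    refine isUnit_det_of_rayleigh (hS k hk) ?_ (rayleigh_pivot hA0 hA hB hU k hk).2
    rintro ⟨γ, hγ, h⟩
    exact div_ne_zero (hU (k + 1) (by omega) γ fun j => hγ j trivial)
      (hU k (by omega) γ fun j => hγ j trivial) h
  set w := blockVec x with hw
  have hrow : ∀ k ≤ N, (-1 : ℝ) ^ k • A k *ᵥ w k + (B k)ᵀ *ᵥ w (k + 1) + lowerPart B w k =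
      r • schurComp n A B k *ᵥ w k := fun k hk => by
    ext i
    have := congrFun heig ⟨⟨k, by omega⟩, i⟩
    rw [Pi.smul_apply, blockDiagonal'_mulVec_apply, blockTri_mulVec_apply] at this
    simpa using this
  have helim : ∀ k ≤ N, pivot n A B r k *ᵥ w k = (B k)ᵀ *ᵥ w (k + 1) := by
    intro k
    induction k with
    | zero =>
      intro _
      have := hrow 0 (by omega)
      simp only [pow_zero, one_smul, lowerPart, add_zero, schurComp] at this
      rw [pivot, sub_smul, one_smul, sub_mulVec, smul_mulVec, ← this, add_sub_cancel_left]
    | succ k ih =>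
      intro hk
      have := hrow (k + 1) hk
      rw [pivot, sub_mulVec, sub_mulVec, smul_mulVec, smul_mulVec, ← this, ← mulVec_mulVec,
        ← ih (by omega), ← mulVec_mulVec, mulVec_mulVec _ _ (pivot n A B r k),
        nonsing_inv_mul _ (hunit k (by omega)), one_mulVec, lowerPart]
      abel
  have hzero : ∀ d ≤ N + 1, w (N + 1 - d) = 0 := by
    intro d
    induction d with
    | zero => exact fun _ => funext fun i => dif_neg (by simp)
    | succ d ih =>
      intro hd
      have hk : N + 1 - d = N + 1 - (d + 1) + 1 := by omega
      have h1 := ih (by omega)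
      rw [hk] at h1
      have h2 := helim (N + 1 - (d + 1)) (by omega)
      rw [h1, mulVec_zero] at h2
      exact eq_zero_of_mulVec_eq_zero (hunit _ (by omega)).ne_zero h2
  refine hx (funext fun ⟨k, i⟩ => ?_)
  have h := hzero (N + 1 - k) (by omega)
  rw [show N + 1 - (N + 1 - (k : ℕ)) = k by omega] at h
  simpa [hw, blockVec_val] using congrFun h i
end
end

section
/- Let k ≥ 1 and γ_1, …, γ_k ∈ [0,1]. Let m be the largest even integer with m ≤ k+1 and m' the largest odd integer with m' ≤ k+1. Then every real zero ξ of U_{k+1}(·, γ) satisfies either −2cos(π/(2k+1)) ≤ ξ ≤ 2cos((m+1)π/(2m+1)) (a negative interval) or 2cos(m'π/(2m'+1)) ≤ ξ ≤ 2cos(π/(2k+3)) (a positive interval). In particular every real zero of U_{k+1}(·, γ) has absolute value at most 2cos(π/(2k+3)) < 2. -/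
noncomputable section

/-- If `P` is a positive decreasing sequence with `P (n+2) ≤ x * P (n+1) - P n`, then a sequence
obeying the parametric recurrence and starting with a ratio at least that of `P` stays positive. -/
theorem pos_of_ratio_ge {N : ℕ} {x : ℝ} {V P g s : ℕ → ℝ}
    (hV : ∀ n, n + 2 ≤ N → V (n + 2) = (x - (1 - g n) * s n) * V (n + 1) - g n * V n)
    (hg : ∀ n, n + 2 ≤ N → g n ∈ Set.Icc (0 : ℝ) 1) (hs : ∀ n, s n ≤ 1)
    (hP : ∀ n, n + 2 ≤ N → P (n + 2) ≤ x * P (n + 1) - P n)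
    (hPpos : ∀ n, n ≤ N → 0 < P n) (hPanti : ∀ n, n + 1 ≤ N → P (n + 1) ≤ P n)
    (hV0 : 0 < V 0) (h01 : V 0 * P 1 ≤ V 1 * P 0) :
    ∀ n, n ≤ N → 0 < V n := by
  have key : ∀ n, n + 1 ≤ N → 0 < V n ∧ 0 < V (n + 1) ∧ V n * P (n + 1) ≤ V (n + 1) * P n := by
    intro n
    induction n with
    | zero =>
      intro h
      have h0 := hPpos 0 (by omega)
      have h1 := hPpos 1 (by omega)
      exact ⟨hV0, pos_of_mul_pos_left ((mul_pos hV0 h1).trans_le h01) h0.le, h01⟩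
    | succ n ih =>
      intro h
      obtain ⟨_, h1, h2⟩ := ih (by omega)
      have hp1 := hPpos (n + 1) (by omega)
      have hp2 := hPpos (n + 2) h
      obtain ⟨hg0, hg1⟩ := hg n h
      have hrat : V (n + 1) * P (n + 2) ≤ V (n + 2) * P (n + 1) := by
        have e1 := mul_le_mul_of_nonneg_left (hP n h) h1.le
        have e2 := mul_le_mul_of_nonneg_left h2 hg0
        have e3 := mul_le_mul_of_nonneg_left (hs n)
          (mul_nonneg (sub_nonneg.2 hg1) (mul_pos h1 hp1).le)
        have e4 := mul_le_mul_of_nonneg_left (hPanti n (by omega))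
          (mul_nonneg (sub_nonneg.2 hg1) h1.le)
        rw [hV n h]
        linarith
      exact ⟨h1, pos_of_mul_pos_left ((mul_pos h1 hp2).trans_le hrat) hp1.le, hrat⟩
  intro n hn
  cases n with
  | zero => exact hV0
  | succ n => exact (key n hn).2.1

theorem exists_ratio_bound {N : ℕ} (hN : 1 ≤ N) {x : ℝ}
    (hx : 2 * Real.cos (Real.pi / (2 * (N : ℝ) + 1)) < x) :
    ∃ P : ℕ → ℝ, (∀ n, P (n + 2) ≤ x * P (n + 1) - P n) ∧ (∀ n, n ≤ N → 0 < P n) ∧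
      (∀ n, n + 1 ≤ N → P (n + 1) ≤ P n) ∧ P 1 ≤ (x - 1) * P 0 := by
  have hpi := Real.pi_pos
  have hN' : (1 : ℝ) ≤ N := by exact_mod_cast hN
  rcases le_or_gt 2 x with h2 | h2
  · exact ⟨fun _ => 1, fun _ => by linarith, fun _ _ => one_pos, fun _ _ => le_rfl, by linarith⟩
  have hc : 0 < Real.cos (Real.pi / (2 * (N : ℝ) + 1)) := by
    apply Real.cos_pos_of_mem_Ioo
    constructor
    · have : 0 < Real.pi / (2 * (N : ℝ) + 1) := by positivity
      linarith
    · rw [div_lt_div_iff₀ (by positivity) two_pos]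
      nlinarith
  set θ := Real.arccos (x / 2) with hθ
  have hcos : Real.cos θ = x / 2 := Real.cos_arccos (by linarith) (by linarith)
  have hθ0 : 0 ≤ θ := Real.arccos_nonneg _
  have hθπ : θ ≤ Real.pi := Real.arccos_le_pi _
  have hθlt : θ < Real.pi / (2 * (N : ℝ) + 1) := by
    by_contra! hle
    have := Real.cos_le_cos_of_nonneg_of_le_pi (by positivity) hθπ hle
    linarith
  rw [lt_div_iff₀ (by positivity)] at hθlt
  have hbd : ∀ n : ℕ, n ≤ N → (2 * (n : ℝ) + 1) * (θ / 2) < Real.pi / 2 := by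
    intro n hn
    have : (n : ℝ) ≤ N := by exact_mod_cast hn
    nlinarith
  refine ⟨fun n => Real.cos ((2 * (n : ℝ) + 1) * (θ / 2)), fun n => ?_, fun n hn => ?_,
    fun n hn => ?_, ?_⟩
  · have e : x = 2 * Real.cos θ := by linarith
    have e1 : (2 * ((n + 2 : ℕ) : ℝ) + 1) * (θ / 2)
        = (2 * ((n + 1 : ℕ) : ℝ) + 1) * (θ / 2) + θ := by push_cast; ring
    have e2 : (2 * (n : ℝ) + 1) * (θ / 2)
        = (2 * ((n + 1 : ℕ) : ℝ) + 1) * (θ / 2) - θ := by push_cast; ring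
    beta_reduce
    rw [e1, e2, e, Real.cos_add, Real.cos_sub]
    linarith
  · have := hbd n hn
    apply Real.cos_pos_of_mem_Ioo
    constructor
    · have : 0 ≤ (2 * (n : ℝ) + 1) * (θ / 2) := by positivity
      linarith
    · exact this
  · have := hbd (n + 1) hn
    apply Real.cos_le_cos_of_nonneg_of_le_pi (by positivity) (by linarith)
    push_cast
    nlinarith
  · have e : x = 2 * Real.cos (2 * (θ / 2)) := by rw [mul_div_cancel₀ θ two_ne_zero]; linarith
    have e1 : (2 * ((1 : ℕ) : ℝ) + 1) * (θ / 2) = 3 * (θ / 2) := by push_cast; ring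
    have e2 : (2 * ((0 : ℕ) : ℝ) + 1) * (θ / 2) = θ / 2 := by push_cast; ring
    simp only [e1, e2]
    rw [e, Real.cos_three_mul, Real.cos_two_mul]
    linarith

/-- Comparison of a sequence obeying the sign-alternating parametric recurrence with the solution
`Q` for which all parameters equal `1`: positivity of the odd terms of `Q` forces positivity. -/
theorem pos_of_alternating_recurrence {N : ℕ} (hN : 1 ≤ N) {x : ℝ} (hx : 0 ≤ x)
    {A Q g : ℕ → ℝ}
    (hA : ∀ n, n + 2 ≤ N → A (n + 2) = g n * A n + (1 - g n + (-1) ^ n * x) * A (n + 1))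
    (hg : ∀ n, n + 2 ≤ N → g n ∈ Set.Icc (0 : ℝ) 1)
    (hQ : ∀ n, n + 2 ≤ N → Q (n + 2) = Q n + (-1) ^ n * x * Q (n + 1))
    (hQodd : ∀ n, n ≤ N → Odd n → 0 < Q n) (hQ0 : 0 < Q 0) (hQ1 : Q 1 ≤ Q 0)
    (hA0 : 0 < A 0) (hA1 : A 1 ≤ A 0) (h01 : Q 1 * A 0 ≤ A 1 * Q 0) :
    0 < A N := by
  have key : ∀ n, n + 1 ≤ N → 0 < A n ∧ 0 < Q n ∧ 0 < A (n + 1) ∧ 0 < Q (n + 1) ∧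
      (Even n → A (n + 1) ≤ A n ∧ Q (n + 1) ≤ Q n ∧ Q (n + 1) * A n ≤ A (n + 1) * Q n) ∧
      (Odd n → A n ≤ A (n + 1) ∧ Q n ≤ Q (n + 1) ∧ A (n + 1) * Q n ≤ Q (n + 1) * A n) := by
    intro n
    induction n with
    | zero =>
      intro h
      have hq1 := hQodd 1 h odd_one
      exact ⟨hA0, hQ0, pos_of_mul_pos_left ((mul_pos hq1 hA0).trans_le h01) hQ0.le, hq1,
        fun _ => ⟨hA1, hQ1, h01⟩, fun h => absurd h (by decide)⟩
    | succ n ih =>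
      intro h
      obtain ⟨ha, hq, ha1, hq1, he, ho⟩ := ih (by omega)
      obtain ⟨hg0, hg1⟩ := hg n h
      have hAn := hA n h
      have hQn := hQ n h
      have hxa := mul_nonneg hx ha1.le
      have hxq := mul_nonneg hx hq1.le
      rcases Nat.even_or_odd n with hn | hn
      · obtain ⟨h1, h2, h3⟩ := he hn
        rw [hn.neg_one_pow] at hAn hQn
        have e1 := mul_le_mul_of_nonneg_left h1 hg0
        have i1 : A (n + 1) ≤ A (n + 2) := by linarith
        have i2 : Q (n + 1) ≤ Q (n + 2) := by linarith
        have i3 : A (n + 2) * Q (n + 1) ≤ Q (n + 2) * A (n + 1) := by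
          have e2 := mul_le_mul_of_nonneg_left h3 hg0
          have e3 := mul_le_mul_of_nonneg_left h2 (mul_nonneg (sub_nonneg.2 hg1) ha1.le)
          rw [hAn, hQn]
          linarith
        exact ⟨ha1, hq1, ha1.trans_le i1, hq1.trans_le i2,
          fun h => absurd h (Nat.not_even_iff_odd.2 hn.add_one), fun _ => ⟨i1, i2, i3⟩⟩
      · obtain ⟨h1, h2, h3⟩ := ho hn
        rw [hn.neg_one_pow] at hAn hQn
        have e1 := mul_le_mul_of_nonneg_left h1 hg0
        have i1 : A (n + 2) ≤ A (n + 1) := by linarith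
        have i2 : Q (n + 2) ≤ Q (n + 1) := by linarith
        have i3 : Q (n + 2) * A (n + 1) ≤ A (n + 2) * Q (n + 1) := by
          have e2 := mul_le_mul_of_nonneg_left h3 hg0
          have e3 := mul_le_mul_of_nonneg_left h2 (mul_nonneg (sub_nonneg.2 hg1) ha1.le)
          rw [hAn, hQn]
          linarith
        have hq2 := hQodd (n + 2) h (by simpa [Nat.odd_add] using hn)
        exact ⟨ha1, hq1, pos_of_mul_pos_left ((mul_pos hq2 ha1).trans_le i3) hq1.le, hq2,
          fun _ => ⟨i1, i2, i3⟩, fun h => absurd hn.add_one (Nat.not_even_iff_odd.2 h)⟩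
  obtain ⟨n, rfl⟩ := Nat.exists_eq_add_of_le' hN
  exact (key n le_rfl).2.2.1

/-- Up to a positive factor, the absolute values near `x = 0` of the polynomials with all
parameters equal to `1`, at `x = 2 sin φ`. -/
def cosSin (φ : ℝ) (n : ℕ) : ℝ :=
  Real.cos ((2 * (n : ℝ) + 1) * (φ / 2)) + (-1) ^ n * Real.sin ((2 * (n : ℝ) + 1) * (φ / 2))

theorem cosSin_add_two (φ : ℝ) (n : ℕ) :
    cosSin φ (n + 2) = cosSin φ n + (-1) ^ n * (2 * Real.sin φ) * cosSin φ (n + 1) := by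
  have e1 : (2 * ((n + 2 : ℕ) : ℝ) + 1) * (φ / 2)
      = (2 * ((n + 1 : ℕ) : ℝ) + 1) * (φ / 2) + φ := by push_cast; ring
  have e2 : (2 * (n : ℝ) + 1) * (φ / 2)
      = (2 * ((n + 1 : ℕ) : ℝ) + 1) * (φ / 2) - φ := by push_cast; ring
  simp only [cosSin, e1, e2, Real.cos_add, Real.cos_sub, Real.sin_add, Real.sin_sub]
  rcases Nat.even_or_odd n with hn | hn
  · simp only [pow_succ, hn.neg_one_pow]; ring
  · simp only [pow_succ, hn.neg_one_pow]; ring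

theorem cosSin_one (φ : ℝ) : cosSin φ 1 = (1 - 2 * Real.sin φ) * cosSin φ 0 := by
  have e : φ = 2 * (φ / 2) := by ring
  have e1 : (2 * ((1 : ℕ) : ℝ) + 1) * (φ / 2) = 3 * (φ / 2) := by push_cast; ring
  have e2 : (2 * ((0 : ℕ) : ℝ) + 1) * (φ / 2) = φ / 2 := by push_cast; ring
  have e3 : Real.sin φ = 2 * Real.sin (φ / 2) * Real.cos (φ / 2) := by
    rw [← Real.sin_two_mul, ← e]
  simp only [cosSin, e1, e2, e3, Real.cos_three_mul, Real.sin_three_mul]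
  have h := Real.sin_sq_add_cos_sq (φ / 2)
  linear_combination (4 * Real.sin (φ / 2) + 4 * Real.cos (φ / 2)) * h

theorem cosSin_pos {φ : ℝ} {n : ℕ} (h : (2 * (n : ℝ) + 1) * |φ| < Real.pi / 2) :
    0 < cosSin φ n := by
  have habs : |(2 * (n : ℝ) + 1) * (φ / 2)| < Real.pi / 4 := by
    rw [abs_mul, abs_div, abs_of_pos (by positivity : (0 : ℝ) < 2 * (n : ℝ) + 1), abs_two]
    linarith
  obtain ⟨h1, h2⟩ := abs_lt.1 habs
  have hpi := Real.pi_pos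
  unfold cosSin
  set α := (2 * (n : ℝ) + 1) * (φ / 2)
  have key : ∀ β : ℝ, -(Real.pi / 4) < β → β < Real.pi / 4 → Real.sin β < Real.cos β := by
    intro β hβ1 hβ2
    rcases le_or_gt β 0 with h0 | h0
    · have := Real.sin_nonpos_of_nonpos_of_neg_pi_le h0 (by linarith)
      have := Real.cos_pos_of_mem_Ioo ⟨(by linarith : -(Real.pi / 2) < β), by linarith⟩
      linarith
    rw [← Real.sin_pi_div_two_sub]
    exact Real.sin_lt_sin_of_lt_of_le_pi_div_two (by linarith) (by linarith) (by linarith)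
  rcases Nat.even_or_odd n with hn | hn
  · have := key (-α) (by linarith) (by linarith)
    rw [Real.sin_neg, Real.cos_neg] at this
    rw [hn.neg_one_pow]
    linarith
  · have := key α h1 h2
    rw [hn.neg_one_pow]
    linarith

/-- `Ufun` multiplied by the signs `+, -, -, +, +, -, -, …` it has near `x = 0`. -/
def signedU (γ : ℕ → ℝ) (x : ℝ) (n : ℕ) : ℝ := (-1) ^ ((n + 1) / 2) * Ufun γ n x

theorem signedU_zero (γ : ℕ → ℝ) (x : ℝ) : signedU γ x 0 = 1 := by simp [signedU, Ufun]

theorem signedU_one (γ : ℕ → ℝ) (x : ℝ) : signedU γ x 1 = 1 - x := by simp [signedU, Ufun]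

theorem signedU_add_two (γ : ℕ → ℝ) (x : ℝ) (n : ℕ) :
    signedU γ x (n + 2) = γ (n + 1) * signedU γ x n +
      (1 - γ (n + 1) + (-1) ^ n * x) * signedU γ x (n + 1) := by
  simp only [signedU, Ufun]
  rcases Nat.even_or_odd' n with ⟨j, rfl | rfl⟩
  · rw [show (2 * j + 2 + 1) / 2 = j + 1 by omega, show (2 * j + 1 + 1) / 2 = j + 1 by omega,
      show (2 * j + 1) / 2 = j by omega]
    simp only [pow_succ, pow_mul]
    norm_num
    ring
  · rw [show (2 * j + 1 + 2 + 1) / 2 = j + 2 by omega,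
      show (2 * j + 1 + 1 + 1) / 2 = j + 1 by omega, show (2 * j + 1 + 1) / 2 = j + 1 by omega]
    simp only [pow_succ, pow_mul]
    norm_num
    ring

theorem Ufun_pos_of_gt {k : ℕ} {γ : ℕ → ℝ}
    (hγ : ∀ t, 1 ≤ t → t ≤ k → γ t ∈ Set.Icc (0 : ℝ) 1) {x : ℝ}
    (hx : 2 * Real.cos (Real.pi / (2 * (k : ℝ) + 3)) < x) : 0 < Ufun γ (k + 1) x := by
  have hx' : 2 * Real.cos (Real.pi / (2 * ((k + 1 : ℕ) : ℝ) + 1)) < x := by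
    rwa [show 2 * ((k + 1 : ℕ) : ℝ) + 1 = 2 * (k : ℝ) + 3 by push_cast; ring]
  obtain ⟨P, hP, hpos, hanti, h1⟩ := exists_ratio_bound (by omega) hx'
  refine pos_of_ratio_ge (V := fun n => Ufun γ n x) (g := fun n => γ (n + 1))
    (s := fun n => (-1) ^ (n + 1)) (fun n _ => ?_) (fun n hn => hγ _ (by omega) (by omega))
    (fun n => ?_) (fun n _ => hP n) hpos hanti ?_ ?_ (k + 1) le_rfl
  · simp only [Ufun]
    ring
  · rcases neg_one_pow_eq_or ℝ (n + 1) with h | h <;> norm_num [h]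
  · simp [Ufun]
  · simpa [Ufun] using h1

theorem Ufun_ne_zero_of_lt {k : ℕ} (hk : 1 ≤ k) {γ : ℕ → ℝ}
    (hγ : ∀ t, 1 ≤ t → t ≤ k → γ t ∈ Set.Icc (0 : ℝ) 1) {x : ℝ}
    (hx : x < -(2 * Real.cos (Real.pi / (2 * (k : ℝ) + 1)))) : Ufun γ (k + 1) x ≠ 0 := by
  obtain ⟨P, hP, hpos, hanti, h1⟩ := exists_ratio_bound hk (lt_neg_of_lt_neg hx)
  have hP0 := hpos 0 (by omega)
  have hx1 : 0 < -x - 1 := pos_of_mul_pos_left ((hpos 1 hk).trans_le h1) hP0.le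
  have hγ1 := hγ 1 le_rfl hk
  have := pos_of_ratio_ge (x := -x) (V := fun n => (-1) ^ (n + 1) * Ufun γ (n + 1) x)
    (g := fun n => γ (n + 2)) (s := fun n => (-1) ^ (n + 1)) (N := k) (P := P)
    (fun n _ => ?_) (fun n hn => hγ _ (by omega) (by omega))
    (fun n => ?_) (fun n _ => hP n) hpos hanti ?_ ?_ k le_rfl
  · intro h0
    simp [h0] at this
  · simp only [Ufun]
    ring
  · rcases neg_one_pow_eq_or ℝ (n + 1) with h | h <;> norm_num [h]
  · simp only [Ufun]
    norm_num
    linarith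
  · have e1 := mul_le_mul_of_nonneg_left h1 (by linarith : 0 ≤ 1 - x)
    have e2 := mul_nonneg (mul_nonneg hγ1.1 (by linarith : 0 ≤ -x)) hP0.le
    simp only [Ufun]
    norm_num
    linarith

theorem Ufun_ne_zero_of_mem_gap {k m m' : ℕ} (hk : 1 ≤ k) {γ : ℕ → ℝ}
    (hγ : ∀ t, 1 ≤ t → t ≤ k → γ t ∈ Set.Icc (0 : ℝ) 1)
    (hm : ∀ n, Even n → n ≤ k + 1 → n ≤ m) (hm' : ∀ n, Odd n → n ≤ k + 1 → n ≤ m') {x : ℝ}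
    (h1 : 2 * Real.cos (((m : ℝ) + 1) * Real.pi / (2 * (m : ℝ) + 1)) < x)
    (h2 : x < 2 * Real.cos ((m' : ℝ) * Real.pi / (2 * (m' : ℝ) + 1))) :
    Ufun γ (k + 1) x ≠ 0 := by
  have hpi := Real.pi_pos
  set b := Real.pi / (2 * (2 * (m : ℝ) + 1)) with hb
  set c := Real.pi / (2 * (2 * (m' : ℝ) + 1)) with hc
  have eb : Real.cos (((m : ℝ) + 1) * Real.pi / (2 * (m : ℝ) + 1)) = Real.sin (-b) := by
    rw [← Real.cos_pi_div_two_sub, hb]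
    congr 1
    field_simp
    ring
  have ec : Real.cos ((m' : ℝ) * Real.pi / (2 * (m' : ℝ) + 1)) = Real.sin c := by
    rw [← Real.cos_pi_div_two_sub, hc]
    congr 1
    field_simp
    ring
  rw [eb] at h1
  rw [ec] at h2
  set φ := Real.arcsin (x / 2) with hφ
  have hsin : 2 * Real.sin φ = x := by
    rw [hφ, Real.sin_arcsin (by linarith [Real.neg_one_le_sin (-b)])
      (by linarith [Real.sin_le_one c])]
    ring
  have hm2 : 2 ≤ m := hm 2 even_two (by omega)
  have hm1 : 1 ≤ m' := hm' 1 odd_one (by omega)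
  have hb_le : b ≤ Real.pi / 2 := by
    rw [hb]
    gcongr
    have : (0 : ℝ) ≤ m := by positivity
    linarith
  have hc_le : c ≤ Real.pi / 2 := by
    rw [hc]
    gcongr
    have : (0 : ℝ) ≤ m' := by positivity
    linarith
  have hφb : -b < φ := by
    by_contra! hle
    have := Real.sin_le_sin_of_le_of_le_pi_div_two (Real.neg_pi_div_two_le_arcsin (x / 2))
      (by have : 0 < b := by positivity
          linarith) hle
    linarith
  have hφc : φ < c := by
    by_contra! hle
    have := Real.sin_le_sin_of_le_of_le_pi_div_two
      (by have : 0 < c := by positivity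
          linarith) (Real.arcsin_le_pi_div_two (x / 2)) hle
    linarith
  have hγ1 := hγ 1 le_rfl hk
  suffices 0 < signedU γ x (k + 1) by
    intro h0
    simp [signedU, h0] at this
  rcases le_total 0 x with hx | hx
  · have hφ0 : 0 ≤ φ := Real.arcsin_nonneg.2 (by linarith)
    have hbd : ∀ n : ℕ, n ≤ m' → 0 < cosSin φ n := by
      intro n hn
      apply cosSin_pos
      have hn' : (n : ℝ) ≤ m' := by exact_mod_cast hn
      rw [abs_of_nonneg hφ0]
      rw [hc, lt_div_iff₀ (by positivity)] at hφc
      nlinarith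
    have hq0 := hbd 0 (by omega)
    have hxq := mul_nonneg hx hq0.le
    have hq1 := cosSin_one φ
    rw [hsin] at hq1
    refine pos_of_alternating_recurrence (by omega) hx (Q := cosSin φ)
      (fun n _ => signedU_add_two γ x n) (fun n hn => hγ _ (by omega) (by omega))
      (fun n _ => ?_) (fun n hn ho => hbd n (hm' n ho hn)) hq0 ?_ ?_ ?_ ?_
    · rw [cosSin_add_two, hsin]
    · linarith
    · rw [signedU_zero]; exact one_pos
    · rw [signedU_zero, signedU_one]; linarith
    · rw [signedU_zero, signedU_one]; linarith
  · have hφ0 : φ ≤ 0 := Real.arcsin_nonpos.2 (by linarith)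
    have hbd : ∀ n : ℕ, n ≤ m → 0 < cosSin φ n := by
      intro n hn
      apply cosSin_pos
      have hn' : (n : ℝ) ≤ m := by exact_mod_cast hn
      rw [abs_of_nonpos hφ0]
      have hφb' : -φ < b := by linarith
      rw [hb, lt_div_iff₀ (by positivity)] at hφb'
      nlinarith
    have hq0 := hbd 0 (by omega)
    have hxq := mul_nonneg (neg_nonneg.2 hx) hq0.le
    have hq1 := cosSin_one φ
    have hq2 := cosSin_add_two φ 0
    simp only [hsin, zero_add, pow_zero, one_mul] at hq1 hq2
    have hA2 := signedU_add_two γ x 0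
    simp only [signedU_zero, signedU_one, zero_add, pow_zero, one_mul, mul_one] at hA2
    refine pos_of_alternating_recurrence (A := fun n => signedU γ x (n + 1)) hk
      (neg_nonneg.2 hx) (Q := fun n => cosSin φ (n + 1)) (g := fun n => γ (n + 2))
      (fun n _ => ?_) (fun n hn => hγ _ (by omega) (by omega))
      (fun n _ => ?_) (fun n hn ho => hbd _ (hm _ ho.add_one (by omega)))
      (hbd 1 (by omega)) ?_ ?_ ?_ ?_
    · simp only [signedU_add_two γ x (n + 1)]
      ring
    · simp only [cosSin_add_two φ (n + 1), hsin]
      ring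
    · simp only [zero_add, Nat.reduceAdd, hq2, hq1]
      nlinarith [mul_nonneg (sq_nonneg x) hq0.le]
    · simp only [zero_add, signedU_one]
      linarith
    · simp only [zero_add, Nat.reduceAdd, hA2, signedU_one]
      nlinarith [mul_nonneg hγ1.1 (neg_nonneg.2 hx), sq_nonneg x, hγ1.2]
    · simp only [zero_add, Nat.reduceAdd, hA2, signedU_one, hq2, hq1]
      have := mul_nonneg (mul_nonneg (sub_nonneg.2 hγ1.2) hxq) (by linarith : 0 ≤ 1 - x)
      linarith

/-- for `k ≥ 1` and `γ₁, …, γ_k ∈ [0,1]`, with `m` the largest even integer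
`≤ k+1` and `m'` the largest odd integer `≤ k+1`, every real zero `ξ` of `U_{k+1}(·, γ)`
lies in `[-2cos(π/(2k+1)), 2cos((m+1)π/(2m+1))]` or in
`[2cos(m'π/(2m'+1)), 2cos(π/(2k+3))]`; in particular `|ξ| ≤ 2cos(π/(2k+3)) < 2`. -/
theorem stmt1 (k : ℕ) (hk : 1 ≤ k) (γ : ℕ → ℝ)
    (hγ : ∀ t, 1 ≤ t → t ≤ k → γ t ∈ Set.Icc (0 : ℝ) 1)
    (m m' : ℕ)
    (hm : m = if Even (k + 1) then k + 1 else k)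
    (hm' : m' = if Odd (k + 1) then k + 1 else k)
    (ξ : ℝ) (hξ : Ufun γ (k + 1) ξ = 0) :
    ((-(2 * Real.cos (Real.pi / (2 * (k : ℝ) + 1))) ≤ ξ ∧
        ξ ≤ 2 * Real.cos (((m : ℝ) + 1) * Real.pi / (2 * (m : ℝ) + 1))) ∨
      (2 * Real.cos ((m' : ℝ) * Real.pi / (2 * (m' : ℝ) + 1)) ≤ ξ ∧
        ξ ≤ 2 * Real.cos (Real.pi / (2 * (k : ℝ) + 3)))) ∧
    |ξ| ≤ 2 * Real.cos (Real.pi / (2 * (k : ℝ) + 3)) ∧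
    2 * Real.cos (Real.pi / (2 * (k : ℝ) + 3)) < 2 := by
  have hpi := Real.pi_pos
  have hd : ξ ≤ 2 * Real.cos (Real.pi / (2 * (k : ℝ) + 3)) :=
    not_lt.1 fun h => (Ufun_pos_of_gt hγ h).ne' hξ
  have ha : -(2 * Real.cos (Real.pi / (2 * (k : ℝ) + 1))) ≤ ξ :=
    not_lt.1 fun h => Ufun_ne_zero_of_lt hk hγ h hξ
  have hle : Real.pi / (2 * (k : ℝ) + 3) ≤ Real.pi / (2 * (k : ℝ) + 1) := by
    gcongr
    norm_num
  have hlepi : Real.pi / (2 * (k : ℝ) + 1) ≤ Real.pi :=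
    div_le_self hpi.le (by linarith [(Nat.cast_nonneg k : (0 : ℝ) ≤ k)])
  have hmono := Real.cos_le_cos_of_nonneg_of_le_pi (by positivity) hlepi hle
  have hlt : Real.cos (Real.pi / (2 * (k : ℝ) + 3)) < 1 := by
    rw [← Real.cos_zero]
    exact Real.cos_lt_cos_of_nonneg_of_le_pi le_rfl (hle.trans hlepi) (by positivity)
  refine ⟨?_, abs_le.2 ⟨by linarith, hd⟩, by linarith⟩
  by_contra! hcon
  refine Ufun_ne_zero_of_mem_gap (m := m) (m' := m') hk hγ (fun n hn hnk => ?_)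
    (fun n hn hnk => ?_) (hcon.1 ha) (not_le.1 fun h => (hcon.2 h).not_ge hd) hξ
  · rw [hm]
    split_ifs with he
    · exact hnk
    · rcases hnk.eq_or_lt with rfl | h
      · exact absurd hn he
      · omega
  · rw [hm']
    split_ifs with ho
    · exact hnk
    · rcases hnk.eq_or_lt with rfl | h
      · exact absurd hn ho
      · omega
end
end

section
/- Let k ≥ 1 and γ ∈ {0,1}^k. Let j_1 < … < j_{ℓ−1} be all indices j ∈ {1,…,k} with γ_j = 0, and set j_0 = 0, j_ℓ = k+1, and k_i = j_i − j_{i−1} for i = 1, …, ℓ. Then the multiset of roots (with multiplicity) of the degree-(k+1) polynomial U_{k+1}(x, γ) equals { 2·(−1)^{j_{i−1}}·cos((2s − 1)π/(2k_i + 1)) : s = 1, …, k_i, i = 1, …, ℓ }; in particular all roots are real. -/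
noncomputable section
open Polynomial

/-- The parametric polynomials `U_k(x, γ)` as actual real polynomials, defined by
`U_0 = 1`, `U_1 = X - 1`, and
`U_{k+1} = (C((-1)^{k+1} (1 - γ_k)) + X) U_k - C(γ_k) U_{k-1}` for `k ≥ 1`. -/
def Upoly (γ : ℕ → ℝ) : ℕ → Polynomial ℝ
  | 0 => 1
  | 1 => X - C 1
  | k+2 => (C ((-1 : ℝ)^(k+2) * (1 - γ (k+1))) + X) * Upoly γ (k+1) - C (γ (k+1)) * Upoly γ k

/-- The polynomials `W_n` with `W_0 = 1`, `W_1 = X - e` and `W_{n+2} = X W_{n+1} - W_n`. For `e = 1`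
these are the rescaled Chebyshev polynomials of the third kind. -/
def chebW (e : ℝ) : ℕ → Polynomial ℝ
  | 0 => 1
  | 1 => X - C e
  | n + 2 => X * chebW e (n + 1) - chebW e n

lemma chebW_monic_natDegree (e : ℝ) (n : ℕ) :
    ((chebW e n).Monic ∧ (chebW e n).natDegree = n) ∧
      (chebW e (n + 1)).Monic ∧ (chebW e (n + 1)).natDegree = n + 1 := by
  induction n with
  | zero => exact ⟨⟨monic_one, natDegree_one⟩, monic_X_sub_C e, natDegree_X_sub_C e⟩
  | succ n ih =>
    obtain ⟨⟨hm, hd⟩, hm', hd'⟩ := ih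
    have hX : (X * chebW e (n + 1)).Monic := monic_X.mul hm'
    have hXd : (X * chebW e (n + 1)).natDegree = n + 2 := by
      rw [monic_X.natDegree_mul hm', natDegree_X, hd']; omega
    have hlt : (chebW e n).natDegree < (X * chebW e (n + 1)).natDegree := by omega
    refine ⟨⟨hm', hd'⟩, ?_, ?_⟩
    · exact hX.sub_of_left (degree_lt_degree hlt)
    · rw [chebW, natDegree_sub_eq_left_of_natDegree_lt hlt, hXd]

lemma chebW_monic (e : ℝ) (n : ℕ) : (chebW e n).Monic := (chebW_monic_natDegree e n).1.1

lemma natDegree_chebW (e : ℝ) (n : ℕ) : (chebW e n).natDegree = n :=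
  (chebW_monic_natDegree e n).1.2

lemma eval_chebW_mul_cos {e : ℝ} (he : e ^ 2 = 1) (t : ℝ) (n : ℕ) :
    (chebW e n).eval (2 * e * Real.cos (2 * t)) * Real.cos t =
      e ^ n * Real.cos ((2 * n + 1) * t) := by
  induction n using Nat.twoStepInduction with
  | zero => simp [chebW]
  | one =>
    have h : (2 * ((1 : ℕ) : ℝ) + 1) * t = 3 * t := by push_cast; ring
    rw [h, Real.cos_three_mul, Real.cos_two_mul]
    simp only [chebW, eval_sub, eval_X, eval_C]
    ring
  | more n ih ih' =>
    have h : Real.cos ((2 * ((n + 2 : ℕ) : ℝ) + 1) * t) + Real.cos ((2 * n + 1) * t) =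
        2 * Real.cos (2 * t) * Real.cos ((2 * ((n + 1 : ℕ) : ℝ) + 1) * t) := by
      rw [Real.cos_add_cos]
      push_cast
      ring_nf
    simp only [chebW, eval_sub, eval_mul, eval_X, sub_mul]
    rw [ih, mul_assoc, ih', eq_sub_of_add_eq h]
    linear_combination e ^ n * Real.cos ((2 * n + 1) * t) * he

lemma roots_chebW {e : ℝ} (he : e ^ 2 = 1) (n : ℕ) :
    (chebW e n).roots = (Multiset.range n).map (fun s : ℕ =>
      2 * e * Real.cos ((2 * (s : ℝ) + 1) * Real.pi / (2 * (n : ℝ) + 1))) := by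
  have he0 : e ≠ 0 := by rintro rfl; norm_num at he
  have hn : (0 : ℝ) < 2 * n + 1 := by positivity
  have hangle : ∀ s ∈ Multiset.range n, 0 ≤ (2 * (s : ℝ) + 1) * Real.pi / (2 * (n : ℝ) + 1) ∧
      (2 * (s : ℝ) + 1) * Real.pi / (2 * (n : ℝ) + 1) < Real.pi := by
    intro s hs
    have hs' : (s : ℝ) < n := by exact_mod_cast Multiset.mem_range.1 hs
    refine ⟨by positivity, ?_⟩
    rw [div_lt_iff₀ hn]
    nlinarith [Real.pi_pos]
  symm
  refine Multiset.eq_of_le_of_card_le ((Multiset.le_iff_subset ?_).2 ?_) ?_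
  · refine Multiset.Nodup.map_on ?_ (Multiset.nodup_range n)
    intro s hs r hr h
    have h' := Real.injOn_cos ⟨(hangle s hs).1, (hangle s hs).2.le⟩
      ⟨(hangle r hr).1, (hangle r hr).2.le⟩ (mul_left_cancel₀ (mul_ne_zero two_ne_zero he0) h)
    rw [div_left_inj' hn.ne', mul_left_inj' Real.pi_ne_zero] at h'
    exact_mod_cast (by linarith : (s : ℝ) = r)
  · intro x hx
    obtain ⟨s, hs, rfl⟩ := Multiset.mem_map.1 hx
    obtain ⟨h0, hpi⟩ := hangle s hs
    rw [mem_roots (chebW_monic e n).ne_zero, IsRoot.def]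
    have h := eval_chebW_mul_cos he ((2 * (s : ℝ) + 1) * Real.pi / (2 * (n : ℝ) + 1) / 2) n
    have hzero : Real.cos ((2 * n + 1) *
        ((2 * (s : ℝ) + 1) * Real.pi / (2 * (n : ℝ) + 1) / 2)) = 0 :=
      Real.cos_eq_zero_iff.2 ⟨s, by push_cast; field_simp⟩
    have hpos : 0 < Real.cos ((2 * (s : ℝ) + 1) * Real.pi / (2 * (n : ℝ) + 1) / 2) :=
      Real.cos_pos_of_mem_Ioo ⟨by linarith [Real.pi_pos], by linarith⟩
    rw [hzero, mul_zero, mul_div_cancel₀ _ (two_ne_zero' ℝ)] at h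
    exact (mul_eq_zero.1 h).resolve_right hpos.ne'
  · rw [Multiset.card_map, Multiset.card_range]
    exact (card_roots' _).trans (natDegree_chebW e n).le

lemma Upoly_add_eq_mul_chebW (γ : ℕ → ℝ) (a b : ℕ) (ha : a = 0 ∨ γ a = 0)
    (hab : ∀ t, a < t → t < b → γ t = 1) (m : ℕ) (hm : a + m ≤ b) :
    Upoly γ (a + m) = Upoly γ a * chebW ((-1) ^ a) m := by
  induction m using Nat.twoStepInduction with
  | zero => simp [chebW]
  | one =>
    cases a with
    | zero => simp [Upoly, chebW]
    | succ c =>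
      have hc : γ (c + 1) = 0 := ha.resolve_left (Nat.succ_ne_zero c)
      rw [show c + 1 + 1 = c + 2 from rfl, Upoly, hc]
      simp only [chebW, sub_zero, mul_one, C_0, zero_mul, pow_succ, C_mul, C_neg, C_1]
      ring
  | more m ih ih' =>
    have h1 : γ (a + m + 1) = 1 := hab _ (by omega) (by omega)
    rw [show a + (m + 2) = a + m + 2 from rfl, Upoly, h1, show a + m + 1 = a + (m + 1) from rfl,
      ih (by omega), ih' (by omega), chebW]
    simp only [sub_self, mul_zero, C_0, C_1]
    ring

/-- for binary parameters `γ ∈ {0,1}^k`, with `j₁ < … < j_{ℓ-1}` the indices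
where `γ` vanishes, `j₀ = 0`, `j_ℓ = k+1` and `k_i = j_i - j_{i-1}`, the multiset of roots
(with multiplicity) of `U_{k+1}(·,γ)` equals
`{2 (-1)^{j_{i-1}} cos((2s-1)π/(2k_i+1)) : s = 1,…,k_i, i = 1,…,ℓ}`. -/
theorem stmt2 (k : ℕ) (hk : 1 ≤ k) (γ : ℕ → ℝ)
    (hγ : ∀ t, 1 ≤ t → t ≤ k → γ t = 0 ∨ γ t = 1)
    (ℓ : ℕ) (hℓ : 1 ≤ ℓ) (j : ℕ → ℕ)
    (hj0 : j 0 = 0) (hjl : j ℓ = k + 1)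
    (hjmono : ∀ i < ℓ, j i < j (i + 1))
    (hjzero : ∀ i, 1 ≤ i → i ≤ ℓ - 1 → γ (j i) = 0)
    (hzeroj : ∀ t, 1 ≤ t → t ≤ k → γ t = 0 → ∃ i, 1 ≤ i ∧ i ≤ ℓ - 1 ∧ j i = t) :
    (Upoly γ (k + 1)).roots =
      (Finset.Icc 1 ℓ).val.bind (fun i =>
        (Multiset.range (j i - j (i - 1))).map (fun s =>
          2 * (-1 : ℝ)^(j (i - 1)) *
            Real.cos ((2 * (s : ℝ) + 1) * Real.pi / (2 * ((j i - j (i - 1) : ℕ) : ℝ) + 1)))) := by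
  have hlt : ∀ i i', i < i' → i' ≤ ℓ → j i < j i' := by
    intro i i' h
    induction i', h using Nat.le_induction with
    | base => exact fun h => hjmono i h
    | succ n _ ih => exact fun h => (ih (by omega)).trans (hjmono n h)
  have hprod : ∀ i ≤ ℓ, Upoly γ (j i) =
      ∏ n ∈ Finset.Icc 1 i, chebW ((-1) ^ j (n - 1)) (j n - j (n - 1)) := by
    intro i
    induction i with
    | zero => intro _; simp [hj0, Upoly]
    | succ i ih =>
      intro hi
      have hij : j i < j (i + 1) := hjmono i hi
      have hle : j (i + 1) ≤ k + 1 := by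
        rcases hi.eq_or_lt with h | h
        · exact (h ▸ hjl).le
        · exact hjl ▸ (hlt _ _ h le_rfl).le
      have hstart : j i = 0 ∨ γ (j i) = 0 := by
        rcases Nat.eq_zero_or_pos i with rfl | h
        · exact Or.inl hj0
        · exact Or.inr (hjzero i h (by omega))
      have hone : ∀ t, j i < t → t < j (i + 1) → γ t = 1 := by
        intro t ht ht'
        refine (hγ t (by omega) (by omega)).resolve_left fun h0 => ?_
        obtain ⟨n, _, hn, rfl⟩ := hzeroj t (by omega) (by omega) h0
        rcases lt_trichotomy n i with h | rfl | h
        · exact (hlt n i h (by omega)).not_gt ht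
        · exact ht.false
        · rcases (Nat.succ_le_of_lt h).eq_or_lt with h' | h'
          · exact ht'.ne (congrArg j h'.symm)
          · exact (hlt _ _ h' (by omega)).not_gt ht'
      have h := Upoly_add_eq_mul_chebW γ (j i) (j (i + 1)) hstart hone (j (i + 1) - j i) (by omega)
      rw [Nat.add_sub_cancel' hij.le, ih (by omega)] at h
      rw [h, Finset.prod_Icc_succ_top (by omega), Nat.add_sub_cancel]
  rw [← hjl, hprod ℓ le_rfl,
    roots_prod _ _ (Finset.prod_ne_zero_iff.2 fun n _ => (chebW_monic _ _).ne_zero)]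
  refine Multiset.bind_congr fun i _ => ?_
  rw [roots_chebW]
  · simp only [Multiset.bind_def, Multiset.pure_def, Multiset.bind_singleton, Multiset.map_map,
      Function.comp_def]
  · rw [← pow_mul, mul_comm, pow_mul, neg_one_sq, one_pow]
end
end

section
/- Every eigenvalue λ of 𝒫̂_SP^{−1}𝒜_SP is real and either satisfies α_E^{(0)} ≤ λ ≤ β_E^{(0)}, or there exist real numbers a ∈ [α_E^{(0)}, β_E^{(0)}], b ∈ [α_E^{(1)}, β_E^{(1)}], and c ∈ [α_R^{(1)}, β_R^{(1)}] such that λ² − (a − b)λ − c − ab = 0. -/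
noncomputable section
open Matrix

/-- Coordinates of `u` in an orthonormal eigenbasis of a real symmetric matrix. -/
lemma Matrix.IsHermitian.exists_eigencoords {n : Type*} [Fintype n] [DecidableEq n]
    {E : Matrix n n ℝ} (hE : E.IsHermitian) (u : n → ℝ) :
    ∃ y : n → ℝ, u ⬝ᵥ u = ∑ i, y i ^ 2 ∧
      u ⬝ᵥ (E *ᵥ u) = ∑ i, hE.eigenvalues i * y i ^ 2 ∧
      (E *ᵥ u) ⬝ᵥ (E *ᵥ u) = ∑ i, hE.eigenvalues i ^ 2 * y i ^ 2 := by
  have parseval : ∀ a b : n → ℝ, a ⬝ᵥ b = ∑ i,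
      ((hE.eigenvectorBasis i).ofLp ⬝ᵥ a) * ((hE.eigenvectorBasis i).ofLp ⬝ᵥ b) := by
    intro a b
    have h := hE.eigenvectorBasis.sum_inner_mul_inner (WithLp.toLp 2 a) (WithLp.toLp 2 b)
    simp only [EuclideanSpace.inner_eq_star_dotProduct, star_trivial] at h
    rw [dotProduct_comm a b, ← h]
    exact Finset.sum_congr rfl fun i _ => by rw [dotProduct_comm b]
  have coord : ∀ i, (hE.eigenvectorBasis i).ofLp ⬝ᵥ (E *ᵥ u) =
      hE.eigenvalues i * ((hE.eigenvectorBasis i).ofLp ⬝ᵥ u) := by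
    intro i
    have hT : Eᵀ = E := by simpa [conjTranspose_eq_transpose_of_trivial] using hE.eq
    rw [dotProduct_mulVec, ← mulVec_transpose, hT, hE.mulVec_eigenvectorBasis, smul_dotProduct,
      smul_eq_mul]
  refine ⟨fun i => (hE.eigenvectorBasis i).ofLp ⬝ᵥ u, ?_, ?_, ?_⟩
  · rw [parseval]
    exact Finset.sum_congr rfl fun i _ => by ring
  · rw [parseval]
    exact Finset.sum_congr rfl fun i _ => by rw [coord]; ring
  · rw [parseval]
    exact Finset.sum_congr rfl fun i _ => by rw [coord]; ring

lemma ciInf_le_and_le_ciSup {n : Type*} [Finite n] (e : n → ℝ) (i : n) :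
    ⨅ j, e j ≤ e i ∧ e i ≤ ⨆ j, e j :=
  ⟨ciInf_le (Set.finite_range e).bddBelow i, le_ciSup (Set.finite_range e).bddAbove i⟩

/-- A weighted mean, with nonnegative weights, of values in `[α, β]` lies in `[α, β]`. -/
lemma div_sum_mem_Icc {n : Type*} [Fintype n] {e t : n → ℝ} {α β : ℝ}
    (he : ∀ i, α ≤ e i ∧ e i ≤ β) (ht : ∀ i, 0 ≤ t i) (hpos : 0 < ∑ i, t i) :
    (∑ i, e i * t i) / ∑ i, t i ∈ Set.Icc α β := by
  rw [Set.mem_Icc, le_div_iff₀ hpos, div_le_iff₀ hpos, Finset.mul_sum, Finset.mul_sum]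
  exact ⟨Finset.sum_le_sum fun i _ => mul_le_mul_of_nonneg_right (he i).1 (ht i),
    Finset.sum_le_sum fun i _ => mul_le_mul_of_nonneg_right (he i).2 (ht i)⟩

/-- The Rayleigh quotient lies between the extreme eigenvalues. -/
lemma Matrix.IsHermitian.rayleigh_mem_Icc {n : Type*} [Fintype n] [DecidableEq n]
    {E : Matrix n n ℝ} (hE : E.IsHermitian) {u : n → ℝ} (hu : u ≠ 0) :
    (u ⬝ᵥ (E *ᵥ u)) / (u ⬝ᵥ u) ∈
      Set.Icc (⨅ i, hE.eigenvalues i) (⨆ i, hE.eigenvalues i) := by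
  obtain ⟨y, h0, h1, -⟩ := hE.exists_eigencoords u
  have hpos : 0 < u ⬝ᵥ u := by simpa using dotProduct_star_self_pos_iff.2 hu
  rw [h0] at hpos
  rw [h0, h1]
  exact div_sum_mem_Icc (ciInf_le_and_le_ciSup _) (fun i => sq_nonneg _) hpos

/-- If `r` is outside the range of the spectrum of `E` and `w = (r - E) u`, then
`⟪w, w⟫ = (r - a) ⟪u, w⟫` for some `a` between the extreme eigenvalues of `E`. -/
lemma Matrix.IsHermitian.exists_mean_value_resolvent {n : Type*} [Fintype n] [DecidableEq n]
    {E : Matrix n n ℝ} (hE : E.IsHermitian) {r : ℝ} {u w : n → ℝ} (hu : u ≠ 0)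
    (hw : E *ᵥ u + w = r • u)
    (hr : ¬ ((⨅ i, hE.eigenvalues i) ≤ r ∧ r ≤ ⨆ i, hE.eigenvalues i)) :
    ∃ a ∈ Set.Icc (⨅ i, hE.eigenvalues i) (⨆ i, hE.eigenvalues i),
      w ⬝ᵥ w = (r - a) * (u ⬝ᵥ w) := by
  obtain ⟨y, h0, h1, h2⟩ := hE.exists_eigencoords u
  set e := hE.eigenvalues
  have hw' : w = r • u - E *ᵥ u := eq_sub_of_add_eq' hw
  have huw : u ⬝ᵥ w = ∑ i, (r - e i) * y i ^ 2 := by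
    rw [hw', dotProduct_sub, dotProduct_smul, h0, h1, smul_eq_mul, Finset.mul_sum,
      ← Finset.sum_sub_distrib]
    exact Finset.sum_congr rfl fun i _ => by ring
  have hww : w ⬝ᵥ w = r * (∑ i, (r - e i) * y i ^ 2) - ∑ i, e i * ((r - e i) * y i ^ 2) := by
    have : w ⬝ᵥ w = r * (u ⬝ᵥ w) - (r * (u ⬝ᵥ (E *ᵥ u)) - (E *ᵥ u) ⬝ᵥ (E *ᵥ u)) := by
      nth_rewrite 1 [hw']
      rw [sub_dotProduct, smul_dotProduct, smul_eq_mul]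
      congr 1
      rw [hw', dotProduct_sub, dotProduct_smul, smul_eq_mul, dotProduct_comm u]
    rw [this, huw, h1, h2, Finset.mul_sum (a := r) (f := fun i => e i * y i ^ 2),
      ← Finset.sum_sub_distrib]
    congr 1
    exact Finset.sum_congr rfl fun i _ => by ring
  have hypos : ∃ i, y i ≠ 0 := by
    by_contra! hy
    exact hu (dotProduct_self_eq_zero.1 (by simp [h0, hy]))
  obtain ⟨k, hk⟩ := hypos
  have he := ciInf_le_and_le_ciSup e
  rcases lt_or_ge r (⨅ i, e i) with hlt | hge
  · have hneg : ∀ i, r - e i < 0 := fun i => by linarith [(he i).1]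
    have hnn : ∀ i, 0 ≤ -((r - e i) * y i ^ 2) := fun i => by
      nlinarith [hneg i, sq_nonneg (y i)]
    have hpos : 0 < ∑ i, -((r - e i) * y i ^ 2) :=
      Finset.sum_pos' (fun i _ => hnn i) ⟨k, Finset.mem_univ k, by
        have := mul_pos (neg_pos.2 (hneg k)) (pow_pos (abs_pos.2 hk) 2)
        rw [sq_abs] at this
        linarith⟩
    refine ⟨_, div_sum_mem_Icc he hnn hpos, ?_⟩
    rw [huw, hww]
    simp only [mul_neg, Finset.sum_neg_distrib, neg_div_neg_eq] at hpos ⊢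
    rw [sub_mul, div_mul_cancel₀ _ (by linarith)]
  · have hgt : (⨆ i, e i) < r := lt_of_not_ge fun h => hr ⟨hge, h⟩
    have hp : ∀ i, 0 < r - e i := fun i => by linarith [(he i).2]
    have hnn : ∀ i, 0 ≤ (r - e i) * y i ^ 2 := fun i =>
      mul_nonneg (hp i).le (sq_nonneg _)
    have hpos : 0 < ∑ i, (r - e i) * y i ^ 2 :=
      Finset.sum_pos' (fun i _ => hnn i) ⟨k, Finset.mem_univ k, by
        have := hp k
        positivity⟩
    refine ⟨_, div_sum_mem_Icc he hnn hpos, ?_⟩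
    rw [huw, hww, sub_mul, div_mul_cancel₀ _ hpos.ne']

/-- A complex eigenvalue of a real symmetric-definite pencil is real, with a real eigenvector. -/
lemma exists_real_eigenvector_of_symm_pencil {m : Type*} [Fintype m]
    {A P : Matrix m m ℝ} (hA : Aᵀ = A) (hPt : Pᵀ = P)
    (hP : ∀ x : m → ℝ, x ≠ 0 → 0 < x ⬝ᵥ (P *ᵥ x)) {lam : ℂ} {v : m → ℂ} (hv : v ≠ 0)
    (h : (A.map (fun x : ℝ => (x : ℂ))).mulVec v =
      lam • (P.map (fun x : ℝ => (x : ℂ))).mulVec v) :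
    ∃ r : ℝ, lam = (r : ℂ) ∧ ∃ x : m → ℝ, x ≠ 0 ∧ A *ᵥ x = r • (P *ᵥ x) := by
  set x : m → ℝ := fun i => (v i).re with hx
  set y : m → ℝ := fun i => (v i).im with hy
  have re_mul : ∀ (M : Matrix m m ℝ) i,
      ((M.map (fun x : ℝ => (x : ℂ))).mulVec v i).re = (M *ᵥ x) i := by
    intro M i
    simp [mulVec, dotProduct, hx]
  have im_mul : ∀ (M : Matrix m m ℝ) i,
      ((M.map (fun x : ℝ => (x : ℂ))).mulVec v i).im = (M *ᵥ y) i := by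
    intro M i
    simp [mulVec, dotProduct, hy]
  have h1 : A *ᵥ x = lam.re • (P *ᵥ x) - lam.im • (P *ᵥ y) := by
    ext i
    have := congrArg Complex.re (congrFun h i)
    rw [re_mul, Pi.smul_apply, smul_eq_mul, Complex.mul_re, re_mul, im_mul] at this
    simpa using this
  have h2 : A *ᵥ y = lam.re • (P *ᵥ y) + lam.im • (P *ᵥ x) := by
    ext i
    have := congrArg Complex.im (congrFun h i)
    rw [im_mul, Pi.smul_apply, smul_eq_mul, Complex.mul_im, re_mul, im_mul] at this
    simpa using this
  have symm : ∀ M : Matrix m m ℝ, Mᵀ = M → y ⬝ᵥ (M *ᵥ x) = x ⬝ᵥ (M *ᵥ y) := by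
    intro M hM
    rw [dotProduct_mulVec, ← mulVec_transpose, hM, dotProduct_comm]
  have hnn : ∀ z : m → ℝ, 0 ≤ z ⬝ᵥ (P *ᵥ z) := fun z => by
    by_cases hz : z = 0
    · simp [hz]
    · exact (hP z hz).le
  have hxy : x ≠ 0 ∨ y ≠ 0 := by
    by_contra! hc
    exact hv (funext fun i => Complex.ext (congrFun hc.1 i) (congrFun hc.2 i))
  have hpos : 0 < x ⬝ᵥ (P *ᵥ x) + y ⬝ᵥ (P *ᵥ y) := by
    rcases hxy with hc | hc
    · linarith [hP _ hc, hnn y]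
    · linarith [hP _ hc, hnn x]
  have him : lam.im = 0 := by
    have hs := symm A hA
    rw [h1, h2, dotProduct_sub, dotProduct_add] at hs
    simp only [dotProduct_smul, smul_eq_mul, symm P hPt] at hs
    have : lam.im * (x ⬝ᵥ (P *ᵥ x) + y ⬝ᵥ (P *ᵥ y)) = 0 := by linarith
    exact (mul_eq_zero.1 this).resolve_right hpos.ne'
  refine ⟨lam.re, Complex.ext rfl (by simpa using him), ?_⟩
  rw [him] at h1 h2
  rcases hxy with hc | hc
  · exact ⟨x, hc, by simpa using h1⟩
  · exact ⟨y, hc, by simpa using h2⟩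

/-- The dichotomy for a real eigenpair of `[[E₀, Rᵀ], [R, -E₁]]`. -/
lemma saddle_point_eigenvalue_dichotomy {n m : Type*} [Fintype n] [Fintype m] [DecidableEq n]
    [DecidableEq m] [Nonempty n] {E0 : Matrix n n ℝ} {E1 : Matrix m m ℝ} {R : Matrix m n ℝ}
    (hE0 : E0.IsHermitian) (hE1 : E1.IsHermitian) (hR : (R * Rᵀ).IsHermitian)
    {r : ℝ} {u : n → ℝ} {p : m → ℝ} (hne : u ≠ 0 ∨ p ≠ 0)
    (h0 : E0 *ᵥ u + Rᵀ *ᵥ p = r • u) (h1 : R *ᵥ u - E1 *ᵥ p = r • p) :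
    ((⨅ i, hE0.eigenvalues i) ≤ r ∧ r ≤ ⨆ i, hE0.eigenvalues i) ∨
      ∃ a b c : ℝ, a ∈ Set.Icc (⨅ i, hE0.eigenvalues i) (⨆ i, hE0.eigenvalues i) ∧
        b ∈ Set.Icc (⨅ i, hE1.eigenvalues i) (⨆ i, hE1.eigenvalues i) ∧
        c ∈ Set.Icc (⨅ i, hR.eigenvalues i) (⨆ i, hR.eigenvalues i) ∧
        r ^ 2 - (a - b) * r - c - a * b = 0 := by
  refine or_iff_not_imp_left.2 fun hr => ?_
  have hp : p ≠ 0 := by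
    rintro rfl
    have hu : u ≠ 0 := by simpa using hne
    have huu : u ⬝ᵥ u ≠ 0 := fun h => hu (dotProduct_self_eq_zero.1 h)
    rw [mulVec_zero, add_zero] at h0
    have := hE0.rayleigh_mem_Icc hu
    rw [h0, dotProduct_smul, smul_eq_mul, mul_div_cancel_right₀ _ huu] at this
    exact hr this
  have hpp : p ⬝ᵥ p ≠ 0 := fun h => hp (dotProduct_self_eq_zero.1 h)
  have key : ∃ a ∈ Set.Icc (⨅ i, hE0.eigenvalues i) (⨆ i, hE0.eigenvalues i),
      (Rᵀ *ᵥ p) ⬝ᵥ (Rᵀ *ᵥ p) = (r - a) * (u ⬝ᵥ (Rᵀ *ᵥ p)) := by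
    by_cases hu : u = 0
    · subst hu
      rw [mulVec_zero, zero_add, smul_zero] at h0
      obtain ⟨i⟩ := ‹Nonempty n›
      exact ⟨_, ciInf_le_and_le_ciSup hE0.eigenvalues i, by simp [h0]⟩
    · exact hE0.exists_mean_value_resolvent hu h0 hr
  obtain ⟨a, ha, haw⟩ := key
  refine ⟨a, _, _, ha, hE1.rayleigh_mem_Icc hp, hR.rayleigh_mem_Icc hp, ?_⟩
  have hc : p ⬝ᵥ ((R * Rᵀ) *ᵥ p) = (Rᵀ *ᵥ p) ⬝ᵥ (Rᵀ *ᵥ p) := by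
    rw [← mulVec_mulVec, dotProduct_mulVec, ← mulVec_transpose]
  have hu : u ⬝ᵥ (Rᵀ *ᵥ p) = r * (p ⬝ᵥ p) + p ⬝ᵥ (E1 *ᵥ p) := by
    rw [mulVec_transpose, dotProduct_comm, ← dotProduct_mulVec, eq_add_of_sub_eq h1,
      dotProduct_add, dotProduct_smul, smul_eq_mul]
  rw [hc, haw, hu]
  field_simp
  ring

/-- every eigenvalue `λ` of `𝒫̂_SP⁻¹ 𝒜_SP` (over `ℂ`) is real and either lies
in `[α_E⁰, β_E⁰]`, or is a root of the quadratic `λ² - (a-b)λ - c - ab` for some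
`a ∈ [α_E⁰, β_E⁰]`, `b ∈ [α_E¹, β_E¹]`, `c ∈ [α_R¹, β_R¹]`. Here `Q0 = Ŝ₀^{1/2}`,
`Q1 = Ŝ₁^{1/2}` are the symmetric positive definite square roots, `E_i = Ŝ_i^{-1/2} A_i
Ŝ_i^{-1/2}`, `R₁ = Ŝ₁^{-1/2} B₁ Ŝ₀^{-1/2}`, and `α/β` are min/max eigenvalues. -/
theorem stmt4 (n0 n1 : ℕ) (hn1 : 0 < n1) (hle : n1 ≤ n0)
    (A0 : Matrix (Fin n0) (Fin n0) ℝ) (A1 : Matrix (Fin n1) (Fin n1) ℝ)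
    (B1 : Matrix (Fin n1) (Fin n0) ℝ)
    (hA0 : A0.PosDef) (hA1 : A1.PosSemidef) (hB1 : B1.rank = n1)
    (S0 : Matrix (Fin n0) (Fin n0) ℝ) (S1 : Matrix (Fin n1) (Fin n1) ℝ)
    (hS0 : S0.PosDef) (hS1 : S1.PosDef)
    (Q0 : Matrix (Fin n0) (Fin n0) ℝ) (hQ0 : Q0.PosDef) (hQ0sq : Q0 * Q0 = S0)
    (Q1 : Matrix (Fin n1) (Fin n1) ℝ) (hQ1 : Q1.PosDef) (hQ1sq : Q1 * Q1 = S1)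
    (hE0 : (Q0⁻¹ * A0 * Q0⁻¹).IsHermitian)
    (hE1 : (Q1⁻¹ * A1 * Q1⁻¹).IsHermitian)
    (hR1 : ((Q1⁻¹ * B1 * Q0⁻¹) * (Q1⁻¹ * B1 * Q0⁻¹)ᵀ).IsHermitian)
    (αE0 βE0 αE1 βE1 αR1 βR1 : ℝ)
    (hαE0 : αE0 = ⨅ i, hE0.eigenvalues i) (hβE0 : βE0 = ⨆ i, hE0.eigenvalues i)
    (hαE1 : αE1 = ⨅ i, hE1.eigenvalues i) (hβE1 : βE1 = ⨆ i, hE1.eigenvalues i)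
    (hαR1 : αR1 = ⨅ i, hR1.eigenvalues i) (hβR1 : βR1 = ⨆ i, hR1.eigenvalues i)
    (lam : ℂ)
    (hlam : ∃ v : (Fin n0 ⊕ Fin n1) → ℂ, v ≠ 0 ∧
      ((Matrix.fromBlocks A0 B1ᵀ B1 (-A1)).map (fun x : ℝ => (x : ℂ))).mulVec v =
        lam • ((Matrix.fromBlocks S0 0 0 S1).map (fun x : ℝ => (x : ℂ))).mulVec v) :
    ∃ r : ℝ, lam = (r : ℂ) ∧
      ((αE0 ≤ r ∧ r ≤ βE0) ∨
        ∃ a b c : ℝ, a ∈ Set.Icc αE0 βE0 ∧ b ∈ Set.Icc αE1 βE1 ∧ c ∈ Set.Icc αR1 βR1 ∧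
          r^2 - (a - b) * r - c - a * b = 0) := by
  have hA0t : A0ᵀ = A0 := by simpa [conjTranspose_eq_transpose_of_trivial] using hA0.isHermitian.eq
  have hA1t : A1ᵀ = A1 := by simpa [conjTranspose_eq_transpose_of_trivial] using hA1.isHermitian.eq
  have hS0t : S0ᵀ = S0 := by simpa [conjTranspose_eq_transpose_of_trivial] using hS0.isHermitian.eq
  have hS1t : S1ᵀ = S1 := by simpa [conjTranspose_eq_transpose_of_trivial] using hS1.isHermitian.eq
  have hQ0t : Q0ᵀ = Q0 := by simpa [conjTranspose_eq_transpose_of_trivial] using hQ0.isHermitian.eq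
  have hQ1t : Q1ᵀ = Q1 := by simpa [conjTranspose_eq_transpose_of_trivial] using hQ1.isHermitian.eq
  have hQ0u : IsUnit Q0.det := hQ0.det_pos.ne'.isUnit
  have hQ1u : IsUnit Q1.det := hQ1.det_pos.ne'.isUnit
  obtain ⟨v, hv, hlam⟩ := hlam
  have hP : ∀ x : Fin n0 ⊕ Fin n1 → ℝ, x ≠ 0 →
      0 < x ⬝ᵥ ((fromBlocks S0 0 0 S1) *ᵥ x) := by
    intro x hx
    obtain ⟨f, g, rfl⟩ : ∃ f g, x = Sum.elim f g := ⟨_, _, (Sum.elim_comp_inl_inr x).symm⟩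
    have hnn0 := hS0.posSemidef.dotProduct_mulVec_nonneg f
    have hnn1 := hS1.posSemidef.dotProduct_mulVec_nonneg g
    simp only [star_trivial] at hnn0 hnn1
    simp only [fromBlocks_mulVec, Sum.elim_comp_inl, Sum.elim_comp_inr, zero_mulVec, add_zero,
      zero_add, sumElim_dotProduct_sumElim]
    by_cases hf : f = 0
    · have hg : g ≠ 0 := by
        rintro rfl
        subst hf
        exact hx (by ext (i | i) <;> rfl)
      have := hS1.dotProduct_mulVec_pos hg
      simp only [star_trivial] at this
      linarith
    · have := hS0.dotProduct_mulVec_pos hf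
      simp only [star_trivial] at this
      linarith
  obtain ⟨r, hr, x, hx, hAx⟩ := exists_real_eigenvector_of_symm_pencil
    (by simp [fromBlocks_transpose, hA0t, hA1t])
    (by simp [fromBlocks_transpose, hS0t, hS1t]) hP hv hlam
  refine ⟨r, hr, ?_⟩
  obtain ⟨f, g, rfl⟩ : ∃ f g, x = Sum.elim f g := ⟨_, _, (Sum.elim_comp_inl_inr x).symm⟩
  simp only [fromBlocks_mulVec, Sum.elim_comp_inl, Sum.elim_comp_inr, zero_mulVec, add_zero,
      zero_add] at hAx
  have e0 : A0 *ᵥ f + B1ᵀ *ᵥ g = r • (S0 *ᵥ f) := funext fun i => congrFun hAx (Sum.inl i)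
  have e1 : B1 *ᵥ f + (-A1) *ᵥ g = r • (S1 *ᵥ g) := funext fun i => congrFun hAx (Sum.inr i)
  have : Nonempty (Fin n0) := ⟨⟨0, hn1.trans_le hle⟩⟩
  have hc0 : ∀ w : Fin n0 → ℝ, Q0⁻¹ *ᵥ (Q0 *ᵥ w) = w := fun w => by
    rw [mulVec_mulVec, nonsing_inv_mul _ hQ0u, one_mulVec]
  have hc1 : ∀ w : Fin n1 → ℝ, Q1⁻¹ *ᵥ (Q1 *ᵥ w) = w := fun w => by
    rw [mulVec_mulVec, nonsing_inv_mul _ hQ1u, one_mulVec]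
  subst hαE0 hβE0 hαE1 hβE1 hαR1 hβR1
  refine saddle_point_eigenvalue_dichotomy hE0 hE1 hR1 (u := Q0 *ᵥ f) (p := Q1 *ᵥ g) ?_ ?_ ?_
  · by_contra! hc
    have hf : f = 0 := by rw [← hc0 f, hc.1, mulVec_zero]
    have hg : g = 0 := by rw [← hc1 g, hc.2, mulVec_zero]
    subst hf hg
    exact hx (by ext (i | i) <;> rfl)
  · have := congrArg (Q0⁻¹ *ᵥ ·) e0
    simp only [mulVec_add, mulVec_smul, ← hQ0sq, ← mulVec_mulVec, hc0] at this
    simp only [transpose_mul, transpose_nonsing_inv, hQ0t, hQ1t, ← mulVec_mulVec, hc0, hc1]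
    exact this
  · have := congrArg (Q1⁻¹ *ᵥ ·) e1
    simp only [mulVec_sub, mulVec_smul, neg_mulVec, ← hQ1sq, ← mulVec_mulVec, hc1,
      ← sub_eq_add_neg] at this
    simp only [← mulVec_mulVec, hc0, hc1]
    exact this
end
end

section
/- The matrix 𝒜 is invertible, and its inertia is determined by the block sizes: 𝒜 has exactly Σ_{k even, 0 ≤ k ≤ N} n_k positive eigenvalues, exactly Σ_{k odd, 1 ≤ k ≤ N} n_k negative eigenvalues, and no zero eigenvalue. -/
noncomputable section
open Matrix

/-- The quadratic form of a real symmetric matrix in the coordinates of an eigenbasis. -/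
theorem dotProduct_mulVec_eq_sum_eigenvalues {ι : Type*} [Fintype ι] [DecidableEq ι]
    {M : Matrix ι ι ℝ} (hM : M.IsHermitian) (x : ι → ℝ) :
    x ⬝ᵥ M *ᵥ x =
      ∑ i, hM.eigenvalues i *
        (((star (hM.eigenvectorUnitary : Matrix ι ι ℝ)) *ᵥ x) i) ^ 2 := by
  set U : Matrix ι ι ℝ := (hM.eigenvectorUnitary : Matrix ι ι ℝ)
  have h : M = U * diagonal hM.eigenvalues * star U := by
    have := hM.spectral_theorem
    rw [Unitary.conjStarAlgAut_apply] at this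
    exact this
  have hs : x ᵥ* U = star U *ᵥ x := by
    rw [star_eq_conjTranspose, conjTranspose_eq_transpose_of_trivial, mulVec_transpose]
  calc x ⬝ᵥ M *ᵥ x = x ⬝ᵥ (U * diagonal hM.eigenvalues * star U) *ᵥ x := by rw [← h]
    _ = (star U *ᵥ x) ⬝ᵥ (diagonal hM.eigenvalues *ᵥ (star U *ᵥ x)) := by
      rw [← mulVec_mulVec, ← mulVec_mulVec, dotProduct_mulVec, hs]
    _ = _ := by
      simp only [dotProduct, mulVec_diagonal]
      exact Finset.sum_congr rfl fun i _ => by ring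

/-- If `ε` times the quadratic form of `M` is positive definite on the kernel of a linear map
into a space of dimension `card κ`, then at most `card κ` eigenvalues of `M` fail to have the
sign of `ε`. -/
theorem card_le_card_add_card_eigenvalues {ι κ : Type*} [Fintype ι] [DecidableEq ι] [Fintype κ]
    {M : Matrix ι ι ℝ} (hM : M.IsHermitian) (ε : ℝ) (P : (ι → ℝ) →ₗ[ℝ] (κ → ℝ))
    (hP : ∀ x, P x = 0 → x ≠ 0 → 0 < ε * (x ⬝ᵥ M *ᵥ x)) :
    Fintype.card ι ≤ Fintype.card κ + Fintype.card {i // 0 < ε * hM.eigenvalues i} := by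
  by_contra! hlt
  let C : (ι → ℝ) →ₗ[ℝ] ({i // 0 < ε * hM.eigenvalues i} → ℝ) :=
    (LinearMap.funLeft ℝ ℝ Subtype.val) ∘ₗ
      (star (hM.eigenvectorUnitary : Matrix ι ι ℝ)).mulVecLin
  have hker : LinearMap.ker (P.prod C) ≠ ⊥ :=
    LinearMap.ker_ne_bot_of_finrank_lt (by simpa using hlt)
  obtain ⟨x, hx, hx0⟩ := Submodule.exists_mem_ne_zero_of_ne_bot hker
  obtain ⟨hPx, hCx⟩ : P x = 0 ∧ C x = 0 := by simpa using hx
  have hpos := hP x hPx hx0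
  rw [dotProduct_mulVec_eq_sum_eigenvalues hM, Finset.mul_sum] at hpos
  refine hpos.not_ge (Finset.sum_nonpos fun i _ => ?_)
  rw [← mul_assoc]
  by_cases hi : 0 < ε * hM.eigenvalues i
  · have : (star (hM.eigenvectorUnitary : Matrix ι ι ℝ) *ᵥ x) i = 0 := congrFun hCx ⟨i, hi⟩
    simp [this]
  · exact mul_nonpos_of_nonpos_of_nonneg (not_lt.mp hi) (sq_nonneg _)

/-- A double sum of a function supported on the three central diagonals. -/
theorem sum_range_sum_range_tridiagonal (f : ℕ → ℕ → ℝ)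
    (hf : ∀ k l, k ≠ l → k ≠ l + 1 → l ≠ k + 1 → f k l = 0) (N : ℕ) :
    ∑ k ∈ Finset.range (N + 1), ∑ l ∈ Finset.range (N + 1), f k l =
      ∑ k ∈ Finset.range (N + 1), f k k +
        ∑ k ∈ Finset.range N, (f (k + 1) k + f k (k + 1)) := by
  induction N with
  | zero => simp
  | succ N ih =>
    have hrow : ∑ l ∈ Finset.range (N + 1), f (N + 1) l = f (N + 1) N := by
      refine Finset.sum_eq_single_of_mem N (by simp) fun l hl hlN => ?_
      have := Finset.mem_range.mp hl
      exact hf _ _ (by omega) (by omega) (by omega)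
    have hcol : ∑ k ∈ Finset.range (N + 1), f k (N + 1) = f N (N + 1) := by
      refine Finset.sum_eq_single_of_mem N (by simp) fun k hk hkN => ?_
      have := Finset.mem_range.mp hk
      exact hf _ _ (by omega) (by omega) (by omega)
    rw [Finset.sum_range_succ (n := N + 1)]
    simp only [Finset.sum_range_succ (fun l => f _ l) (N + 1)]
    rw [Finset.sum_add_distrib, ih, hrow, hcol,
      Finset.sum_range_succ (fun k => f (k + 1) k + f k (k + 1)) N]
    ring

/-- A matrix of full row rank has injective transpose action. -/
theorem vecMul_injective_of_rank_eq_card {m n : Type*} [Fintype m] [Fintype n]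
    {B : Matrix m n ℝ} (hB : B.rank = Fintype.card m) :
    Function.Injective fun v : m → ℝ => v ᵥ* B := by
  refine vecMul_injective_iff.mpr ?_
  rw [linearIndependent_iff_card_eq_finrank_span, ← hB, rank_eq_finrank_span_row]
  rfl

section SchurComplement

variable {n : ℕ → ℕ} (A : ∀ k : ℕ, Matrix (Fin (n k)) (Fin (n k)) ℝ)
  (B : ∀ k : ℕ, Matrix (Fin (n (k + 1))) (Fin (n k)) ℝ)

/-- The Schur complements `S_0 = A_0`, `S_{k+1} = A_{k+1} + B_k S_k⁻¹ B_kᵀ`. -/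
def schurComplement : ∀ k : ℕ, Matrix (Fin (n k)) (Fin (n k)) ℝ
  | 0 => A 0
  | k + 1 => A (k + 1) + B k * (schurComplement k)⁻¹ * (B k)ᵀ

theorem schurComplement_posDef {N : ℕ} (hA0 : (A 0).PosDef)
    (hA : ∀ k, 1 ≤ k → k ≤ N → (A k).PosSemidef)
    (hB : ∀ k < N, (B k).rank = n (k + 1)) (k : ℕ) (hk : k ≤ N) :
    (schurComplement A B k).PosDef := by
  induction k with
  | zero => exact hA0
  | succ k ih =>
    refine PosDef.posSemidef_add (hA _ (by omega) hk) ?_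
    have h := (ih (by omega)).inv.mul_mul_conjTranspose_same (B := B k)
      (vecMul_injective_of_rank_eq_card (by simpa using hB k hk))
    rwa [conjTranspose_eq_transpose_of_trivial] at h

/-- The coordinates `X_k + (-1)^k S_k⁻¹ B_kᵀ X_{k+1}` in which the quadratic form of the block
tridiagonal matrix becomes block diagonal. -/
def schurCoord (X : ∀ k, Fin (n k) → ℝ) (k : ℕ) : Fin (n k) → ℝ :=
  X k + (-1 : ℝ) ^ k • ((schurComplement A B k)⁻¹ * (B k)ᵀ) *ᵥ X (k + 1)

theorem schurCoord_quadratic (X : ∀ k, Fin (n k) → ℝ) (k : ℕ)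
    (hS : (schurComplement A B k).PosDef) :
    (-1 : ℝ) ^ k * (schurCoord A B X k ⬝ᵥ schurComplement A B k *ᵥ schurCoord A B X k) =
      (-1 : ℝ) ^ k * (X k ⬝ᵥ schurComplement A B k *ᵥ X k) + 2 * (X (k + 1) ⬝ᵥ B k *ᵥ X k) +
        (-1 : ℝ) ^ k *
          (X (k + 1) ⬝ᵥ (schurComplement A B (k + 1) - A (k + 1)) *ᵥ X (k + 1)) := by
  have hT : (schurComplement A B k)ᵀ = schurComplement A B k := by
    rw [← conjTranspose_eq_transpose_of_trivial]; exact hS.isHermitian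
  have hU : IsUnit (schurComplement A B k).det := hS.det_pos.ne'.isUnit
  have hsub : schurComplement A B (k + 1) - A (k + 1) =
      B k * (schurComplement A B k)⁻¹ * (B k)ᵀ := by simp [schurComplement]
  rw [hsub, schurCoord]
  set S := schurComplement A B k
  set w := (S⁻¹ * (B k)ᵀ) *ᵥ X (k + 1) with hw
  have hSw : S *ᵥ w = (B k)ᵀ *ᵥ X (k + 1) := by
    rw [hw, mulVec_mulVec, ← Matrix.mul_assoc, mul_nonsing_inv _ hU, Matrix.one_mul]
  have hXw : ∀ z, z ⬝ᵥ S *ᵥ w = X (k + 1) ⬝ᵥ B k *ᵥ z := fun z => by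
    rw [hSw, mulVec_transpose, dotProduct_comm, ← dotProduct_mulVec]
  have hwX : w ⬝ᵥ S *ᵥ X k = X k ⬝ᵥ S *ᵥ w := by
    rw [dotProduct_mulVec, ← mulVec_transpose, hT, dotProduct_comm]
  have hww : X (k + 1) ⬝ᵥ (B k * S⁻¹ * (B k)ᵀ) *ᵥ X (k + 1) = X (k + 1) ⬝ᵥ B k *ᵥ w := by
    rw [hw, mulVec_mulVec, Matrix.mul_assoc]
  rw [hww]
  simp only [mulVec_add, mulVec_smul, dotProduct_add, add_dotProduct, smul_dotProduct,
    dotProduct_smul, smul_eq_mul, hwX, hXw]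
  have h1 : ((-1 : ℝ) ^ k) * (-1) ^ k = 1 := by rw [← mul_pow]; simp
  linear_combination (2 * (X (k + 1) ⬝ᵥ B k *ᵥ X k) +
    (-1 : ℝ) ^ k * (X (k + 1) ⬝ᵥ B k *ᵥ w)) * h1

theorem sum_schurCoord_quadratic (X : ∀ k, Fin (n k) → ℝ) (m : ℕ)
    (hS : ∀ k < m, (schurComplement A B k).PosDef) :
    ∑ k ∈ Finset.range m,
        (-1 : ℝ) ^ k * (schurCoord A B X k ⬝ᵥ schurComplement A B k *ᵥ schurCoord A B X k) =
      ∑ k ∈ Finset.range m,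
          ((-1 : ℝ) ^ k * (X k ⬝ᵥ A k *ᵥ X k) + 2 * (X (k + 1) ⬝ᵥ B k *ᵥ X k)) -
        (-1 : ℝ) ^ m * (X m ⬝ᵥ (schurComplement A B m - A m) *ᵥ X m) := by
  induction m with
  | zero => simp [schurComplement]
  | succ m ih =>
    rw [Finset.sum_range_succ, Finset.sum_range_succ, ih fun k hk => hS k (by omega),
      schurCoord_quadratic A B X m (hS m (by omega)), sub_mulVec (schurComplement A B m),
      dotProduct_sub]
    ring

end SchurComplement

section BlockVector

variable (N : ℕ) (n : ℕ → ℕ)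

/-- The `k`-th block of a block vector, extended by zero to all `k : ℕ`. -/
def block (k : ℕ) : ((Σ k : Fin (N + 1), Fin (n k.val)) → ℝ) →ₗ[ℝ] (Fin (n k) → ℝ) :=
  if h : k < N + 1 then LinearMap.funLeft ℝ ℝ fun i => ⟨⟨k, h⟩, i⟩ else 0

variable {N n}

theorem block_fin (x : (Σ k : Fin (N + 1), Fin (n k.val)) → ℝ) (k : Fin (N + 1))
    (i : Fin (n k)) : block N n k x i = x ⟨k, i⟩ := by
  rw [block, dif_pos k.isLt]
  rfl

theorem block_of_lt (x : (Σ k : Fin (N + 1), Fin (n k.val)) → ℝ) {k : ℕ} (h : N < k) :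
    block N n k x = 0 := by
  simp [block, show ¬ k < N + 1 by omega]

variable (A : ∀ k : ℕ, Matrix (Fin (n k)) (Fin (n k)) ℝ)
  (B : ∀ k : ℕ, Matrix (Fin (n (k + 1))) (Fin (n k)) ℝ)

/-- The `(k, l)` block of the infinite block tridiagonal matrix. -/
def triBlock (k l : ℕ) : Matrix (Fin (n k)) (Fin (n l)) ℝ := fun i j =>
  if h : k = l then (-1 : ℝ) ^ k * A k i (Fin.cast (congrArg n h.symm) j)
  else if h2 : k = l + 1 then B l (Fin.cast (congrArg n h2) i) j
  else if h3 : l = k + 1 then B k (Fin.cast (congrArg n h3) j) i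
  else 0

theorem triBlock_self (k : ℕ) : triBlock A B k k = (-1 : ℝ) ^ k • A k := by
  ext i j; simp [triBlock]

theorem triBlock_succ_left (k : ℕ) : triBlock A B (k + 1) k = B k := by
  ext i j; simp [triBlock]

theorem triBlock_succ_right (k : ℕ) : triBlock A B k (k + 1) = (B k)ᵀ := by
  ext i j; simp [triBlock, show k ≠ k + 1 + 1 by omega]

theorem triBlock_eq_zero {k l : ℕ} (h : k ≠ l) (h2 : k ≠ l + 1) (h3 : l ≠ k + 1) :
    triBlock A B k l = 0 := by
  ext i j; simp [triBlock, h, h2, h3]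

theorem blockTri_quadratic (x : (Σ k : Fin (N + 1), Fin (n k.val)) → ℝ) :
    x ⬝ᵥ blockTri N n A B *ᵥ x =
      ∑ k ∈ Finset.range (N + 1), ((-1 : ℝ) ^ k * (block N n k x ⬝ᵥ A k *ᵥ block N n k x) +
        2 * (block N n (k + 1) x ⬝ᵥ B k *ᵥ block N n k x)) := by
  have hsum : x ⬝ᵥ blockTri N n A B *ᵥ x =
      ∑ k ∈ Finset.range (N + 1), ∑ l ∈ Finset.range (N + 1),
        block N n k x ⬝ᵥ triBlock A B k l *ᵥ block N n l x := by
    rw [← Fin.sum_univ_eq_sum_range fun k => ∑ l ∈ Finset.range (N + 1),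
        block N n k x ⬝ᵥ triBlock A B k l *ᵥ block N n l x]
    simp only [dotProduct, mulVec, Fintype.sum_sigma]
    refine Finset.sum_congr rfl fun k _ => ?_
    rw [← Fin.sum_univ_eq_sum_range fun l => ∑ i, block N n k x i *
      ∑ j, triBlock A B k l i j * block N n l x j, Finset.sum_comm]
    refine Finset.sum_congr rfl fun i _ => ?_
    rw [Finset.mul_sum]
    simp only [block_fin]
    rfl
  rw [hsum, sum_range_sum_range_tridiagonal _ (fun k l h h2 h3 => by
    simp [triBlock_eq_zero A B h h2 h3]), Finset.sum_add_distrib (s := Finset.range (N + 1)),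
    Finset.sum_range_succ (fun k => 2 * (block N n (k + 1) x ⬝ᵥ B k *ᵥ block N n k x)) N,
    block_of_lt x (Nat.lt_succ_self N)]
  simp only [triBlock_self, triBlock_succ_left, triBlock_succ_right, smul_mulVec,
    dotProduct_smul, smul_eq_mul, zero_dotProduct, mul_zero, add_zero]
  congr 1
  refine Finset.sum_congr rfl fun k _ => ?_
  rw [mulVec_transpose, dotProduct_comm (block N n k x), ← dotProduct_mulVec]
  ring

/-- The Schur coordinates of the blocks whose index satisfies `p`. -/
def schurCoordMap (p : Fin (N + 1) → Prop) :
    ((Σ k : Fin (N + 1), Fin (n k.val)) → ℝ) →ₗ[ℝ]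
      ((Σ k : {k : Fin (N + 1) // p k}, Fin (n k.val.val)) → ℝ) :=
  LinearMap.pi fun q => LinearMap.proj q.2 ∘ₗ
    (block N n q.1.val + (-1 : ℝ) ^ (q.1.val : ℕ) •
      ((schurComplement A B q.1.val)⁻¹ * (B q.1.val)ᵀ).mulVecLin ∘ₗ block N n (q.1.val + 1))

theorem schurCoordMap_apply (p : Fin (N + 1) → Prop)
    (x : (Σ k : Fin (N + 1), Fin (n k.val)) → ℝ)
    (q : Σ k : {k : Fin (N + 1) // p k}, Fin (n k.val.val)) :
    schurCoordMap A B p x q = schurCoord A B (fun k => block N n k x) q.1.val q.2 := rfl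

theorem eq_zero_of_schurCoord_eq_zero (x : (Σ k : Fin (N + 1), Fin (n k.val)) → ℝ)
    (h : ∀ k ≤ N, schurCoord A B (fun k => block N n k x) k = 0) : x = 0 := by
  have hblock : ∀ j k, k + j = N + 1 → block N n k x = 0 := by
    intro j
    induction j with
    | zero => exact fun k hk => block_of_lt x (by omega)
    | succ j ih =>
      intro k hk
      simpa [schurCoord, ih (k + 1) (by omega)] using h k (by omega)
  ext ⟨k, i⟩
  rw [← block_fin x k i, hblock (N + 1 - k) k (by omega)]
  rfl

/-- The form of the block tridiagonal matrix has the sign `ε` on the vectors whose Schur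
coordinates vanish in all blocks `k` with `(-1)^k ≠ ε`. -/
theorem blockTri_quadratic_pos
    (hS : ∀ k ≤ N, (schurComplement A B k).PosDef) (ε : ℝ) (p : Fin (N + 1) → Prop)
    (hp : ∀ k, ¬ p k → ε * (-1 : ℝ) ^ (k : ℕ) = 1)
    (x : (Σ k : Fin (N + 1), Fin (n k.val)) → ℝ)
    (hx : schurCoordMap A B p x = 0) (hx0 : x ≠ 0) :
    0 < ε * (x ⬝ᵥ blockTri N n A B *ᵥ x) := by
  set y := schurCoord A B (fun k => block N n k x) with hy
  have hq := sum_schurCoord_quadratic A B (fun k => block N n k x) (N + 1)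
    fun k hk => hS k (by omega)
  rw [← blockTri_quadratic, block_of_lt x (Nat.lt_succ_self N), zero_dotProduct, mul_zero,
    sub_zero, ← hy] at hq
  rw [← hq, Finset.mul_sum]
  have hyp : ∀ k : Fin (N + 1), p k → y k = 0 := fun k hk => by
    ext i
    exact congrFun hx ⟨⟨k, hk⟩, i⟩
  have hterm : ∀ k : Fin (N + 1), y k ≠ 0 →
      0 < ε * ((-1 : ℝ) ^ (k : ℕ) * (y k ⬝ᵥ schurComplement A B k *ᵥ y k)) := by
    intro k hk
    rw [← mul_assoc, hp k fun h => hk (hyp k h), one_mul]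
    simpa using (hS k (by omega)).dotProduct_mulVec_pos hk
  obtain ⟨k, hkN, hk⟩ : ∃ k ≤ N, y k ≠ 0 := by
    by_contra! h
    exact hx0 (eq_zero_of_schurCoord_eq_zero A B x h)
  refine Finset.sum_pos' (fun l hl => ?_)
    ⟨k, Finset.mem_range.mpr (by omega), hterm ⟨k, by omega⟩ hk⟩
  by_cases h : y l = 0
  · simp [h]
  · exact (hterm ⟨l, Finset.mem_range.mp hl⟩ h).le

end BlockVector

/-- the matrix `𝒜` is invertible and its inertia is determined by the block
sizes: it has exactly `∑_{k even} n_k` positive eigenvalues, exactly `∑_{k odd} n_k`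
negative eigenvalues, and no zero eigenvalue. -/
theorem stmt8 (N : ℕ) (hN : 1 ≤ N) (n : ℕ → ℕ) (hnN : 1 ≤ n N)
    (hmono : ∀ k < N, n (k + 1) ≤ n k)
    (A : ∀ k : ℕ, Matrix (Fin (n k)) (Fin (n k)) ℝ)
    (B : ∀ k : ℕ, Matrix (Fin (n (k + 1))) (Fin (n k)) ℝ)
    (hA0 : (A 0).PosDef)
    (hA : ∀ k, 1 ≤ k → k ≤ N → (A k).PosSemidef)
    (hB : ∀ k < N, (B k).rank = n (k + 1))
    (hHerm : (blockTri N n A B).IsHermitian) :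
    IsUnit (blockTri N n A B) ∧
    Fintype.card {p : Σ k : Fin (N + 1), Fin (n k.val) // 0 < hHerm.eigenvalues p} =
      ∑ k ∈ Finset.univ.filter (fun k : Fin (N + 1) => Even (k : ℕ)), n (k : ℕ) ∧
    Fintype.card {p : Σ k : Fin (N + 1), Fin (n k.val) // hHerm.eigenvalues p < 0} =
      ∑ k ∈ Finset.univ.filter (fun k : Fin (N + 1) => Odd (k : ℕ)), n (k : ℕ) ∧
    ∀ p, hHerm.eigenvalues p ≠ 0 := by
  have hS := schurComplement_posDef A B hA0 hA hB
  have hcard : ∀ (p : Fin (N + 1) → Prop) [DecidablePred p],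
      Fintype.card (Σ k : {k : Fin (N + 1) // p k}, Fin (n k.val.val)) =
        ∑ k ∈ Finset.univ.filter p, n (k : ℕ) := fun p _ => by
    rw [Fintype.card_sigma, Finset.sum_subtype (p := p) (F := inferInstance) _ (by simp)]
    simp
  have hpos := card_le_card_add_card_eigenvalues hHerm 1
    (schurCoordMap A B fun k : Fin (N + 1) => Odd (k : ℕ))
    (blockTri_quadratic_pos A B hS 1 _ fun k hk => by
      rw [(Nat.not_odd_iff_even.mp hk).neg_one_pow, one_mul])
  have hneg := card_le_card_add_card_eigenvalues hHerm (-1)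
    (schurCoordMap A B fun k : Fin (N + 1) => Even (k : ℕ))
    (blockTri_quadratic_pos A B hS (-1) _ fun k hk => by
      rw [(Nat.not_even_iff_odd.mp hk).neg_one_pow]; norm_num)
  rw [hcard] at hpos hneg
  simp only [one_mul, neg_one_mul, neg_pos] at hpos hneg
  have htotal : Fintype.card (Σ k : Fin (N + 1), Fin (n k.val)) =
      ∑ k ∈ Finset.univ.filter (fun k : Fin (N + 1) => Even (k : ℕ)), n (k : ℕ) +
        ∑ k ∈ Finset.univ.filter (fun k : Fin (N + 1) => Odd (k : ℕ)), n (k : ℕ) := by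
    simp only [← Nat.not_even_iff_odd]
    rw [Finset.sum_filter_add_sum_filter_not, Fintype.card_sigma]
    simp
  have hle : Fintype.card {p // 0 < hHerm.eigenvalues p} +
      Fintype.card {p // hHerm.eigenvalues p < 0} + Fintype.card {p // hHerm.eigenvalues p = 0} =
      Fintype.card (Σ k : Fin (N + 1), Fin (n k.val)) := by
    rw [← Fintype.card_subtype_or_disjoint, ← Fintype.card_subtype_or_disjoint,
      Fintype.card_of_subtype Finset.univ, Finset.card_univ]
    · intro p
      rcases lt_trichotomy (hHerm.eigenvalues p) 0 with h | h | h <;> simp [h]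
    · rw [Pi.disjoint_iff]; intro p; simp only [Prop.disjoint_iff]; rintro ⟨h | h, h'⟩ <;> linarith
    · rw [Pi.disjoint_iff]; intro p; simp only [Prop.disjoint_iff]; rintro ⟨h, h'⟩; linarith
  have hzero : ∀ p, hHerm.eigenvalues p ≠ 0 := by
    have : Fintype.card {p // hHerm.eigenvalues p = 0} = 0 := by omega
    exact fun p hp => (Fintype.card_eq_zero_iff.mp this).false ⟨p, hp⟩
  refine ⟨?_, by omega, by omega, hzero⟩
  rw [isUnit_iff_isUnit_det, hHerm.det_eq_prod_eigenvalues, isUnit_iff_ne_zero,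
    Finset.prod_ne_zero_iff]
  exact fun p _ => by simpa using hzero p
end
end
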